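/- arXiv:2408.04599 — 5 statements merged into one kernel-verified Lean document; each statement's English description precedes it below -/
import Mathlib

section
/- Let d ≥ 3 be an integer and let G be a d-regular graph. Let c > 0 and let U ⊆ V(G) be a finite set of vertices such that e_G(U) ≤ (1+c)|U| and e_G(U ∪ N(U)) ≤ (1+c)|U ∪ N(U)|. Then |U ∪ N(U)| ≥ (d-1-c)|U|/(1+c). -/
open scoped Classical

/-- Number of edges of `G` with both endpoints in `U`. -/
noncomputable def edgesWithin {V : Type*} (G : SimpleGraph V) (U : Set V) : ℕ :=
  {e ∈ G.edgeSet | ∀ v ∈ e, v ∈ U}.ncard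

/-- Number of edges of `G` with exactly one endpoint in `U`. -/
noncomputable def edgesAcross {V : Type*} (G : SimpleGraph V) (U : Set V) : ℕ :=
  {e ∈ G.edgeSet | (∃ a ∈ e, a ∈ U) ∧ (∃ b ∈ e, b ∉ U)}.ncard

/-- `G` is `d`-regular. -/
def isRegular {V : Type*} (G : SimpleGraph V) (d : ℕ) : Prop :=
  ∀ v, (G.neighborSet v).ncard = d

/-- The number of vertices of the connected component of `v` in `H`. -/
noncomputable def compCard {V : Type*} (H : SimpleGraph V) (v : V) : ℕ :=
  {u | H.Reachable v u}.ncard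

/-- The weight of the edge subset `S` under `p`-bond percolation on `G`. -/
noncomputable def percWeight {V : Type*} [Fintype V] (G : SimpleGraph V) (p : ℝ)
    (S : Finset (Sym2 V)) : ℝ :=
  p ^ S.card * (1 - p) ^ (G.edgeFinset.card - S.card)

/-- The probability, under `p`-bond percolation on `G` (each edge retained independently
with probability `p`), that the retained edge set satisfies `Q`. -/
noncomputable def percProb {V : Type*} [Fintype V] (G : SimpleGraph V) (p : ℝ)
    (Q : Finset (Sym2 V) → Prop) : ℝ :=
  ∑ S ∈ G.edgeFinset.powerset, if Q S then percWeight G p S else 0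

/-- The probability, under two independent bond percolations on `G` with probabilities
`p₁` and `p₂`, that the pair of retained edge sets satisfies `Q`. -/
noncomputable def percProb2 {V : Type*} [Fintype V] (G : SimpleGraph V) (p₁ p₂ : ℝ)
    (Q : Finset (Sym2 V) → Finset (Sym2 V) → Prop) : ℝ :=
  ∑ S₁ ∈ G.edgeFinset.powerset, ∑ S₂ ∈ G.edgeFinset.powerset,
    if Q S₁ S₂ then percWeight G p₁ S₁ * percWeight G p₂ S₂ else 0

/-- Edges inside `U` are counted twice from `U`, and every other edge meeting `U` once; when `W`
contains `U` and all its neighbours, all these edges lie within `W`. -/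
lemma sum_degree_le_edgesWithin_add {V : Type*} [Fintype V] (G : SimpleGraph V) {U W : Set V}
    (hUW : U ⊆ W) (hW : ∀ u ∈ U, ∀ v, G.Adj u v → v ∈ W) :
    ∑ u ∈ U.toFinset, G.degree u ≤ edgesWithin G W + edgesWithin G U := by
  have key (X : Set V) :
      edgesWithin G X = ∑ e ∈ G.edgeFinset, if ∀ v ∈ e, v ∈ X then 1 else 0 := by
    rw [← Finset.card_filter, edgesWithin, ← Set.ncard_coe_finset]
    congr 1
    ext e
    simp
  have hdeg : ∑ u ∈ U.toFinset, G.degree u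
      = ∑ e ∈ G.edgeFinset, (U.toFinset.filter (· ∈ e)).card := by
    refine Eq.trans (Finset.sum_congr rfl fun u _ => ?_)
      (Finset.sum_card_bipartiteAbove_eq_sum_card_bipartiteBelow (fun (u : V) e => u ∈ e))
    rw [← G.card_incidenceFinset_eq_degree, G.incidenceFinset_eq_filter]
    rfl
  rw [hdeg, key, key, ← Finset.sum_add_distrib]
  refine Finset.sum_le_sum fun e he => ?_
  induction e using Sym2.ind with
  | _ a b =>
    have hab : G.Adj a b := by simpa using he
    have hfilter : U.toFinset.filter (· ∈ s(a, b)) = ({a, b} : Finset V).filter (· ∈ U) := by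
      ext x
      simp [and_comm]
    have hWa : a ∈ U → b ∈ W := fun ha => hW a ha b hab
    have hWb : b ∈ U → a ∈ W := fun hb => hW b hb a hab.symm
    have hUa : a ∈ U → a ∈ W := fun ha => hUW ha
    have hUb : b ∈ U → b ∈ W := fun hb => hUW hb
    rw [hfilter, Finset.card_filter, Finset.sum_pair hab.ne]
    simp only [Sym2.mem_iff, forall_eq_or_imp, forall_eq]
    split_ifs <;> first | omega | tauto

/-- Let `d ≥ 3` and let `G` be a `d`-regular graph. Let `c > 0` and let
`U` be a finite set of vertices with `e_G(U) ≤ (1+c)|U|` and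
`e_G(U ∪ N(U)) ≤ (1+c)|U ∪ N(U)|`. Then `|U ∪ N(U)| ≥ (d-1-c)|U|/(1+c)`. -/
theorem statement_4 {V : Type*} [Fintype V] (d : ℕ) (hd : 3 ≤ d)
    (G : SimpleGraph V) (hreg : isRegular G d) (c : ℝ) (hc : 0 < c) (U : Set V)
    (hU : (edgesWithin G U : ℝ) ≤ (1 + c) * U.ncard)
    (hUN : (edgesWithin G (U ∪ {v | v ∉ U ∧ ∃ u ∈ U, G.Adj u v}) : ℝ)
        ≤ (1 + c) * (U ∪ {v | v ∉ U ∧ ∃ u ∈ U, G.Adj u v}).ncard) :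
    ((d : ℝ) - 1 - c) * U.ncard / (1 + c)
      ≤ ((U ∪ {v | v ∉ U ∧ ∃ u ∈ U, G.Adj u v}).ncard : ℝ) := by
  set W := U ∪ {v | v ∉ U ∧ ∃ u ∈ U, G.Adj u v}
  have hcount : d * U.ncard ≤ edgesWithin G W + edgesWithin G U := by
    have hdeg : ∑ u ∈ U.toFinset, G.degree u = d * U.ncard := by
      rw [Finset.sum_const_nat (m := d), Set.ncard_eq_toFinset_card', mul_comm]
      intro u _
      rw [← hreg u, Set.ncard_eq_toFinset_card', ← G.card_neighborFinset_eq_degree]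
      rfl
    rw [← hdeg]
    refine sum_degree_le_edgesWithin_add G Set.subset_union_left fun u hu v huv => ?_
    by_cases hv : v ∈ U
    · exact Or.inl hv
    · exact Or.inr ⟨hv, u, hu, huv⟩
  have hcount' : (d : ℝ) * U.ncard ≤ edgesWithin G W + edgesWithin G U := by
    exact_mod_cast hcount
  rw [div_le_iff₀ (by linarith)]
  linarith
end

section
/- Let 0 < c < 1/4 and let G be a graph such that every set U ⊆ V(G) with |U| ≤ 3/(4c) satisfies e_G(U) ≤ (1+c)|U|. Then any two distinct cycles in G, each of length at most 1/(4c), are at graph distance at least 1/(4c) from each other. -/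
open scoped Classical

namespace SimpleGraph

variable {V : Type*} {G : SimpleGraph V}

/-- Deleting an edge of a cycle keeps a connected graph connected. -/
lemma Connected.deleteEdges_singleton_of_mem_cycle (hG : G.Connected) {u : V} {p : G.Walk u u}
    (hp : p.IsCycle) {e : Sym2 V} (he : e ∈ p.edges) : (G.deleteEdges {e}).Connected := by
  induction e with
  | _ x y =>
    refine hG.connected_delete_edge_of_not_isBridge fun hb ↦ ?_
    exact (isBridge_iff_forall_cycle_notMem (p.edges_subset_edgeSet he)).mp hb p hp he

/-- A connected graph with a cycle that has an edge outside another cycle has more edges than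
vertices. -/
lemma Connected.card_lt_ncard_edgeSet_of_mem_edges_of_notMem_edges [Finite V] (hG : G.Connected)
    {u v : V} {p : G.Walk u u} {q : G.Walk v v} (hp : p.IsCycle) (hq : q.IsCycle) {e : Sym2 V}
    (hep : e ∈ p.edges) (heq : e ∉ q.edges) : Nat.card V < G.edgeSet.ncard := by
  have hq' := Walk.IsCycle.toDeleteEdges G ({e} : Set (Sym2 V)) hq (by grind)
  obtain ⟨f, hf⟩ := List.exists_mem_of_ne_nil _ (mt Walk.edges_eq_nil.mp hq'.not_nil)
  have hcard := ((hG.deleteEdges_singleton_of_mem_cycle hp hep).deleteEdges_singleton_of_mem_cycle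
    hq' hf).card_vert_le_card_edgeSet_add_one
  have hfG := Walk.edges_subset_edgeSet _ hf
  rw [Nat.card_coe_set_eq, edgeSet_deleteEdges] at hcard
  have hdelf := Set.ncard_sdiff_singleton_add_one hfG
  rw [edgeSet_deleteEdges] at hcard hdelf
  have hdele := Set.ncard_sdiff_singleton_add_one (p.edges_subset_edgeSet hep)
  omega

/-- A connected graph with two distinct cycles has more edges than vertices. -/
lemma Connected.card_lt_ncard_edgeSet_of_edges_ne [Finite V] (hG : G.Connected)
    {u v : V} {p : G.Walk u u} {q : G.Walk v v} (hp : p.IsCycle) (hq : q.IsCycle)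
    (hne : {e | e ∈ p.edges} ≠ {e | e ∈ q.edges}) : Nat.card V < G.edgeSet.ncard := by
  by_contra hlt
  refine hne (Set.ext fun e ↦ ⟨fun he ↦ ?_, fun he ↦ ?_⟩) <;> by_contra he'
  · exact hlt (hG.card_lt_ncard_edgeSet_of_mem_edges_of_notMem_edges hp hq he he')
  · exact hlt (hG.card_lt_ncard_edgeSet_of_mem_edges_of_notMem_edges hq hp he he')

lemma Walk.IsCycle.induce {s : Set V} {u : V} {p : G.Walk u u} (hp : p.IsCycle)
    (hs : ∀ x ∈ p.support, x ∈ s) : (p.induce s hs).IsCycle :=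
  .of_map (f := (Embedding.induce s).toHom) (by rwa [Walk.map_induce])

lemma Walk.edges_map_induce {s : Set V} {u v : V} (p : G.Walk u v)
    (hs : ∀ x ∈ p.support, x ∈ s) :
    (p.induce s hs).edges.map (Sym2.map Subtype.val) = p.edges :=
  (Walk.edges_map (Embedding.induce s).toHom (p.induce s hs)).symm.trans
    (congrArg Walk.edges (p.map_induce hs))

lemma ncard_edgeSet_induce_le_edgesWithin [Finite V] (G : SimpleGraph V) (U : Set V) :
    (G.induce U).edgeSet.ncard ≤ edgesWithin G U := by
  refine Set.ncard_le_ncard_of_injOn (Sym2.map Subtype.val) (fun e he ↦ ?_)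
    (Sym2.map.injective Subtype.val_injective).injOn (Set.toFinite _)
  induction e with
  | _ x y => simpa using he

lemma Walk.ncard_support_le {u v : V} (p : G.Walk u v) :
    {x | x ∈ p.support}.ncard ≤ p.length + 1 := by
  classical
  rw [← List.coe_toFinset, Set.ncard_coe_finset, ← p.length_support]
  exact p.support.toFinset_card_le

lemma Walk.IsCycle.ncard_support_le {u : V} {p : G.Walk u u} (hp : p.IsCycle) :
    {x | x ∈ p.support}.ncard ≤ p.length := by
  classical
  have hsupp : {x | x ∈ p.support} = (p.support.tail.toFinset : Set V) := by
    ext x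
    have hu := Walk.end_mem_tail_support hp.not_nil
    rw [Set.mem_ofPred_eq, Walk.mem_support_iff, List.coe_toFinset, Set.mem_ofPred_eq]
    exact ⟨fun h ↦ h.elim (· ▸ hu) id, Or.inr⟩
  rw [hsupp, Set.ncard_coe_finset]
  simpa using p.support.tail.toFinset_card_le

/-- Two distinct cycles joined by a walk span a small vertex set containing more edges than
vertices. -/
lemma Walk.IsCycle.exists_ncard_le_and_lt_edgesWithin [Finite V] {u v x y : V}
    {p : G.Walk u u} {q : G.Walk v v} (hp : p.IsCycle) (hq : q.IsCycle)
    (hne : {e | e ∈ p.edges} ≠ {e | e ∈ q.edges})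
    (hx : x ∈ p.support) (hy : y ∈ q.support) (w : G.Walk x y) :
    ∃ U : Set V, U.ncard ≤ p.length + w.length + q.length ∧ U.ncard < edgesWithin G U := by
  set P : Set V := {z | z ∈ p.support}
  set W : Set V := {z | z ∈ w.support}
  set Q : Set V := {z | z ∈ q.support}
  have hPW : (P ∩ W).Nonempty := ⟨x, hx, w.start_mem_support⟩
  have hPWQ : ((P ∪ W) ∩ Q).Nonempty := ⟨y, Or.inr w.end_mem_support, hy⟩
  refine ⟨P ∪ W ∪ Q, ?_, ?_⟩
  · have hunion := Set.ncard_union_add_ncard_inter P W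
    have hpos := hPW.ncard_pos
    have hP : P.ncard ≤ p.length := hp.ncard_support_le
    have hQ : Q.ncard ≤ q.length := hq.ncard_support_le
    have hW : W.ncard ≤ w.length + 1 := w.ncard_support_le
    have hle := Set.ncard_union_le (P ∪ W) Q
    omega
  · have hconn : (G.induce (P ∪ W ∪ Q)).Connected :=
      induce_union_connected
        (induce_union_connected p.connected_induce_support.preconnected
          w.connected_induce_support.preconnected hPW).preconnected
        q.connected_induce_support.preconnected hPWQ
    have hpU : ∀ z ∈ p.support, z ∈ P ∪ W ∪ Q := fun z hz ↦ Or.inl (Or.inl hz)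
    have hqU : ∀ z ∈ q.support, z ∈ P ∪ W ∪ Q := fun z hz ↦ Or.inr hz
    rw [← Nat.card_coe_set_eq]
    refine (hconn.card_lt_ncard_edgeSet_of_edges_ne (hp.induce hpU) (hq.induce hqU)
      fun heq ↦ hne ?_).trans_le (ncard_edgeSet_induce_le_edgesWithin G _)
    ext e
    rw [Set.mem_ofPred_eq, Set.mem_ofPred_eq, ← p.edges_map_induce hpU, ← q.edges_map_induce hqU,
      List.mem_map, List.mem_map]
    exact exists_congr fun f ↦ and_congr_left' (Set.ext_iff.mp heq f)

end SimpleGraph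

/-- Let `0 < c < 1/4` and let `G` be a graph in which every set `U` with
`|U| ≤ 3/(4c)` satisfies `e_G(U) ≤ (1+c)|U|`. Then any two distinct cycles of `G`, each of
length at most `1/(4c)`, are at graph distance at least `1/(4c)` from each other (that is,
every walk from a vertex of one to a vertex of the other has length at least `1/(4c)`).
Cycles are regarded as subgraphs: two cycles are distinct when their edge sets differ. -/
theorem statement_6 {V : Type*} [Fintype V] (c : ℝ) (hc₀ : 0 < c) (hc₁ : c < 1/4)
    (G : SimpleGraph V)
    (hloc : ∀ U : Set V, (U.ncard : ℝ) ≤ 3 / (4 * c) →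
      (edgesWithin G U : ℝ) ≤ (1 + c) * U.ncard)
    (u v : V) (c₁ : G.Walk u u) (c₂ : G.Walk v v)
    (h₁ : c₁.IsCycle) (h₂ : c₂.IsCycle)
    (hl₁ : (c₁.length : ℝ) ≤ 1 / (4 * c)) (hl₂ : (c₂.length : ℝ) ≤ 1 / (4 * c))
    (hne : ({e | e ∈ c₁.edges} : Set (Sym2 V)) ≠ {e | e ∈ c₂.edges}) :
    ∀ x ∈ c₁.support, ∀ y ∈ c₂.support, ∀ w : G.Walk x y,
      1 / (4 * c) ≤ (w.length : ℝ) := by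
  intro x hx y hy w
  by_contra! hw
  obtain ⟨U, hUle, hUlt⟩ := h₁.exists_ncard_le_and_lt_edgesWithin h₂ hne hx hy w
  have hUle' : (U.ncard : ℝ) ≤ c₁.length + w.length + c₂.length := mod_cast hUle
  have hUlt' : (U.ncard : ℝ) + 1 ≤ edgesWithin G U := mod_cast hUlt
  have hthree : 3 / (4 * c) = 3 * (1 / (4 * c)) := by ring
  have hU : (U.ncard : ℝ) ≤ 3 / (4 * c) := by linarith
  have hedges := hloc U hU
  have hcU : c * U.ncard ≤ c * (3 / (4 * c)) := by gcongr
  have hc : c * (3 / (4 * c)) = 3 / 4 := by field_simp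
  linarith
end

section
/- Let d ≥ 3 be an integer and let c > 0 be a sufficiently small constant. Let G be a d-regular graph on n vertices such that every set U ⊆ V(G) with |U| ≤ 3/(4c) satisfies e_G(U) ≤ (1+c)|U|, and such that any two distinct cycles in G of length at most 1/(4c) are at graph distance at least 1/(4c) from each other. Then the number of cycles of length at most 1/(4c) in G is at most n/(d-1)^{1/(8c)}. -/
open scoped Classical

/-- The edges of `G` with both endpoints in `U`, as a finset. -/
noncomputable def insideEdges {V : Type*} [Fintype V] (G : SimpleGraph V) (U : Finset V) :
    Finset (Sym2 V) :=
  {e ∈ G.edgeFinset | ∀ v ∈ e, v ∈ U}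

/-- The set of vertices at distance at most `k` from `C`. -/
noncomputable def thickening {V : Type*} [Fintype V] (G : SimpleGraph V) (C : Finset V) :
    ℕ → Finset V
  | 0 => C
  | k + 1 => thickening G C k ∪ (thickening G C k).biUnion fun v => G.neighborFinset v

section Counting

variable {V : Type*} [Fintype V] {G : SimpleGraph V}

lemma edgesWithin_coe (U : Finset V) : edgesWithin G (U : Set V) = (insideEdges G U).card := by
  rw [edgesWithin, ← Set.ncard_coe_finset]
  congr 1
  ext e
  simp [insideEdges]

lemma mem_insideEdges {U : Finset V} {e : Sym2 V} :
    e ∈ insideEdges G U ↔ e ∈ G.edgeSet ∧ ∀ v ∈ e, v ∈ U := by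
  simp [insideEdges]

lemma mk_mem_insideEdges {U : Finset V} {x y : V} :
    s(x, y) ∈ insideEdges G U ↔ G.Adj x y ∧ x ∈ U ∧ y ∈ U := by
  simp [mem_insideEdges]

lemma insideEdges_mono {U W : Finset V} (h : U ⊆ W) : insideEdges G U ⊆ insideEdges G W := by
  intro e he
  rw [mem_insideEdges] at he ⊢
  exact ⟨he.1, fun v hv => h (he.2 v hv)⟩

lemma thickening_subset_succ (C : Finset V) (k : ℕ) :
    thickening G C k ⊆ thickening G C (k + 1) :=
  Finset.subset_union_left

lemma mem_thickening_succ {C : Finset V} {k : ℕ} {x : V} :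
    x ∈ thickening G C (k + 1) ↔
      x ∈ thickening G C k ∨ ∃ y ∈ thickening G C k, G.Adj y x := by
  simp [thickening]

lemma exists_walk_of_mem_thickening {C : Finset V} {k : ℕ} {x : V}
    (hx : x ∈ thickening G C k) : ∃ a ∈ C, ∃ w : G.Walk a x, w.length ≤ k := by
  induction k generalizing x with
  | zero => exact ⟨x, hx, .nil, le_rfl⟩
  | succ k ih =>
    rcases mem_thickening_succ.1 hx with h | ⟨y, hy, hyx⟩
    · obtain ⟨a, ha, w, hw⟩ := ih h
      exact ⟨a, ha, w, by omega⟩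
    · obtain ⟨a, ha, w, hw⟩ := ih hy
      exact ⟨a, ha, w.concat hyx, by simpa using hw⟩

/-- A connected unicyclic skeleton of a thickening: an injective assignment of an inner edge to
every vertex, such that each vertex lies in a small set, containing `C`, closed under it. -/
lemma exists_skeleton {C : Finset V} (hC : C.card ≤ (insideEdges G C).card) (k : ℕ) :
    ∃ f : V → Sym2 V, Set.InjOn f (thickening G C k) ∧
      ∀ x ∈ thickening G C k, ∃ U ⊆ thickening G C k, C ⊆ U ∧ x ∈ U ∧ (U \ C).card ≤ k ∧
        ∀ u ∈ U, f u ∈ insideEdges G U := by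
  induction k with
  | zero =>
    obtain ⟨S, hS, hcard⟩ := Finset.exists_subset_card_eq hC
    let e := Finset.equivOfCardEq hcard.symm
    refine ⟨fun v => if h : v ∈ C then (e ⟨v, h⟩ : Sym2 V) else s(v, v), ?_, ?_⟩
    · intro a ha b hb hab
      replace ha : a ∈ C := ha
      replace hb : b ∈ C := hb
      simpa [ha, hb, Subtype.coe_inj] using hab
    · intro x hx
      refine ⟨C, subset_rfl, subset_rfl, hx, by simp, fun u hu => ?_⟩
      simp only [hu, dite_true]
      exact hS (e ⟨u, hu⟩).2
  | succ k ih =>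
    obtain ⟨f, hinj, hf⟩ := ih
    have hnew : ∀ v, v ∈ thickening G C (k + 1) → v ∉ thickening G C k →
        ∃ y ∈ thickening G C k, G.Adj y v := fun v hv hv' =>
      (mem_thickening_succ.1 hv).resolve_left hv'
    choose! q hq hadj using hnew
    have hfk : ∀ v ∈ thickening G C k, f v ∈ insideEdges G (thickening G C k) := by
      intro v hv
      obtain ⟨U, hU, -, hvU, -, h⟩ := hf v hv
      exact insideEdges_mono hU (h v hvU)
    refine ⟨fun v => if v ∈ thickening G C k then f v else s(v, q v), ?_, ?_⟩
    · intro a ha b hb hab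
      have ha' := Finset.mem_coe.1 ha
      have hb' := Finset.mem_coe.1 hb
      by_cases h₁ : a ∈ thickening G C k <;> by_cases h₂ : b ∈ thickening G C k <;>
        simp only [h₁, h₂, if_true, if_false] at hab
      · exact hinj h₁ h₂ hab
      · have := hfk a h₁
        rw [hab, mk_mem_insideEdges] at this
        exact absurd this.2.1 h₂
      · have := hfk b h₂
        rw [← hab, mk_mem_insideEdges] at this
        exact absurd this.2.1 h₁
      · rcases Sym2.eq_iff.1 hab with h | h
        · exact h.1
        · exact absurd (h.1 ▸ hq b hb' h₂) h₁
    · intro x hx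
      by_cases h : x ∈ thickening G C k
      · obtain ⟨U, hU, hCU, hxU, hcard, hfU⟩ := hf x h
        refine ⟨U, hU.trans (thickening_subset_succ C k), hCU, hxU, by omega, fun u hu => ?_⟩
        simpa [hU hu] using hfU u hu
      · obtain ⟨U, hU, hCU, hqU, hcard, hfU⟩ := hf (q x) (hq x hx h)
        refine ⟨insert x U, ?_, hCU.trans (Finset.subset_insert _ _),
          Finset.mem_insert_self _ _, ?_, fun u hu => ?_⟩
        · exact Finset.insert_subset hx (hU.trans (thickening_subset_succ C k))
        · calc (insert x U \ C).card ≤ (insert x (U \ C)).card :=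
                Finset.card_le_card (by intro y; simp; tauto)
            _ ≤ (U \ C).card + 1 := Finset.card_insert_le _ _
            _ ≤ k + 1 := by omega
        · rcases Finset.mem_insert.1 hu with rfl | hu
          · simp only [h, if_false, mk_mem_insideEdges]
            exact ⟨(hadj _ hx h).symm, by simp, by simp [hqU]⟩
          · simp only [hU hu, if_true]
            exact insideEdges_mono (Finset.subset_insert _ _) (hfU u hu)

/-- If sets of at most `m` vertices span at most as many edges as they have vertices, then so do
the thickenings, of any size, of a set spanning at least as many edges as vertices. -/
lemma card_insideEdges_thickening_le {m : ℕ}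
    (hG : ∀ U : Finset V, U.card ≤ m → (insideEdges G U).card ≤ U.card)
    {C : Finset V} (hC : C.card ≤ (insideEdges G C).card) {k : ℕ} (hk : C.card + 2 * k ≤ m) :
    (insideEdges G (thickening G C k)).card ≤ (thickening G C k).card := by
  by_contra! hlt
  obtain ⟨f, hinj, hf⟩ := exists_skeleton hC k
  obtain ⟨e, he, hef⟩ : ∃ e ∈ insideEdges G (thickening G C k),
      e ∉ (thickening G C k).image f :=
    Finset.exists_mem_notMem_of_card_lt_card (by rwa [Finset.card_image_of_injOn hinj])
  induction e with | _ x y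
  obtain ⟨-, hx, hy⟩ := mk_mem_insideEdges.1 he
  obtain ⟨U, hU, hCU, hxU, hUcard, hfU⟩ := hf x hx
  obtain ⟨W, hW, hCW, hyW, hWcard, hfW⟩ := hf y hy
  have hsub : U ∪ W ⊆ thickening G C k := Finset.union_subset hU hW
  have hcard : (U ∪ W).card ≤ m := by
    calc (U ∪ W).card ≤ (C ∪ ((U \ C) ∪ (W \ C))).card :=
          Finset.card_le_card (by intro z; simp; tauto)
      _ ≤ C.card + ((U \ C).card + (W \ C).card) :=
          (Finset.card_union_le _ _).trans (by gcongr; exact Finset.card_union_le _ _)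
      _ ≤ m := by omega
  have himage : insert s(x, y) ((U ∪ W).image f) ⊆ insideEdges G (U ∪ W) := by
    refine Finset.insert_subset ?_ (Finset.image_subset_iff.2 fun u hu => ?_)
    · rw [mk_mem_insideEdges] at he ⊢
      simp [he.1, hxU, hyW]
    · rcases Finset.mem_union.1 hu with hu | hu
      · exact insideEdges_mono Finset.subset_union_left (hfU u hu)
      · exact insideEdges_mono Finset.subset_union_right (hfW u hu)
  have hle := Finset.card_le_card himage
  rw [Finset.card_insert_of_notMem fun h => hef (Finset.image_subset_image hsub h),
    Finset.card_image_of_injOn (hinj.mono (by exact_mod_cast hsub))] at hle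
  have := hG _ hcard
  omega

/-- Double counting of the edges meeting a set in a `d`-regular graph. -/
lemma mul_card_thickening_le {d : ℕ} (hreg : isRegular G d) (C : Finset V) (k : ℕ) :
    d * (thickening G C k).card ≤
      (insideEdges G (thickening G C (k + 1))).card + (insideEdges G (thickening G C k)).card := by
  set B := thickening G C k
  set B' := thickening G C (k + 1)
  have hdeg : ∀ v ∈ B, d ≤ ((insideEdges G B').bipartiteAbove (fun v e => v ∈ e) v).card := by
    intro v hv
    rw [← hreg v, ← Set.coe_toFinset (G.neighborSet v), Set.ncard_coe_finset]
    refine Finset.card_le_card_of_injOn (fun w => s(v, w)) ?_ ?_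
    · intro w hw
      have hw' : G.Adj v w := by simpa using hw
      simp only [Finset.coe_bipartiteAbove, Set.mem_ofPred_eq, mk_mem_insideEdges]
      exact ⟨⟨hw', thickening_subset_succ C k hv, mem_thickening_succ.2 (.inr ⟨v, hv, hw'⟩)⟩,
        by simp⟩
    · intro a _ b _ hab
      exact Sym2.congr_right.1 hab
  have hedge : ∀ e ∈ insideEdges G B', (B.bipartiteBelow (fun v e => v ∈ e) e).card ≤
      1 + if e ∈ insideEdges G B then 1 else 0 := by
    intro e he
    induction e with | _ x y
    have hxy := (mk_mem_insideEdges.1 he).1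
    have hsub : B.bipartiteBelow (fun v e => v ∈ e) s(x, y) ⊆ {x, y} := by
      intro z; simp [Finset.mem_bipartiteBelow]
    split_ifs with h
    · exact (Finset.card_le_card hsub).trans Finset.card_le_two
    · rw [mk_mem_insideEdges] at h
      refine Finset.card_le_one.2 fun a ha b hb => ?_
      simp only [Finset.mem_bipartiteBelow, Sym2.mem_iff] at ha hb
      rcases ha with ⟨ha, rfl | rfl⟩ <;> rcases hb with ⟨hb, rfl | rfl⟩ <;> tauto
  calc d * B.card = ∑ _v ∈ B, d := by simp [mul_comm]
    _ ≤ ∑ v ∈ B, ((insideEdges G B').bipartiteAbove (fun v e => v ∈ e) v).card :=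
        Finset.sum_le_sum hdeg
    _ = ∑ e ∈ insideEdges G B', (B.bipartiteBelow (fun v e => v ∈ e) e).card :=
        Finset.sum_card_bipartiteAbove_eq_sum_card_bipartiteBelow _
    _ ≤ ∑ e ∈ insideEdges G B', (1 + if e ∈ insideEdges G B then 1 else 0) :=
        Finset.sum_le_sum hedge
    _ = (insideEdges G B').card + (insideEdges G B' ∩ insideEdges G B).card := by
        rw [Finset.sum_add_distrib, Finset.sum_ite_mem]; simp
    _ ≤ _ := by gcongr; exact Finset.inter_subset_right

lemma card_mul_pow_le_card_thickening {d m : ℕ} (hreg : isRegular G d)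
    (hG : ∀ U : Finset V, U.card ≤ m → (insideEdges G U).card ≤ U.card)
    {C : Finset V} (hC : C.card ≤ (insideEdges G C).card) {k : ℕ} (hk : C.card + 2 * k ≤ m) :
    C.card * (d - 1) ^ k ≤ (thickening G C k).card := by
  induction k with
  | zero => simp [thickening]
  | succ k ih =>
    have h₁ := card_insideEdges_thickening_le hG hC (k := k) (by omega)
    have h₂ := card_insideEdges_thickening_le hG hC hk
    have h₃ := mul_card_thickening_le hreg C k
    have h₄ := Nat.mul_le_mul_right (d - 1) (ih (by omega))
    rw [mul_assoc, ← pow_succ] at h₄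
    refine h₄.trans ?_
    rw [mul_comm, Nat.sub_mul]
    omega

/-- Two disjoint sets, each spanning at least as many edges as vertices, are far apart. -/
lemma lt_card_add_card_add_length {m : ℕ}
    (hG : ∀ U : Finset V, U.card ≤ m → (insideEdges G U).card ≤ U.card)
    {a b : V} (w : G.Walk a b) {A B : Finset V} (ha : a ∈ A) (hb : b ∈ B) (hAB : Disjoint A B)
    (hA : A.card ≤ (insideEdges G A).card) (hB : B.card ≤ (insideEdges G B).card) :
    m + 1 < A.card + B.card + w.length := by
  induction w generalizing A with
  | nil => exact absurd hb (Finset.disjoint_left.1 hAB ha)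
  | @cons a v b hadj p ih =>
    rw [SimpleGraph.Walk.length_cons]
    by_cases hvB : v ∈ B
    · by_contra! hle
      have haB := Finset.disjoint_left.1 hAB ha
      have hvA := Finset.disjoint_right.1 hAB hvB
      have hdisj : Disjoint (insideEdges G A) (insideEdges G B) := by
        rw [Finset.disjoint_left]
        intro e he he'
        induction e with | _ x y
        exact Finset.disjoint_left.1 hAB (mk_mem_insideEdges.1 he).2.1
          (mk_mem_insideEdges.1 he').2.1
      have hsub : insert s(a, v) (insideEdges G A ∪ insideEdges G B) ⊆ insideEdges G (A ∪ B) := by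
        refine Finset.insert_subset ?_ (Finset.union_subset
          (insideEdges_mono Finset.subset_union_left)
          (insideEdges_mono Finset.subset_union_right))
        simp [mk_mem_insideEdges, hadj, ha, hvB]
      have h := Finset.card_le_card hsub
      rw [Finset.card_insert_of_notMem (by simp [mk_mem_insideEdges, haB, hvA]),
        Finset.card_union_of_disjoint hdisj] at h
      have h' := hG (A ∪ B)
      rw [Finset.card_union_of_disjoint hAB] at h'
      have := h' (by omega)
      omega
    · by_cases hvA : v ∈ A
      · have := ih hvA hb hAB hA
        omega
      · have hsub : insert s(a, v) (insideEdges G A) ⊆ insideEdges G (insert v A) :=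
          Finset.insert_subset (by simp [mk_mem_insideEdges, hadj, ha])
            (insideEdges_mono (Finset.subset_insert _ _))
        have h := Finset.card_le_card hsub
        rw [Finset.card_insert_of_notMem (by simp [mk_mem_insideEdges, hvA])] at h
        have hcard := Finset.card_insert_of_notMem hvA
        have := ih (Finset.mem_insert_self v A) hb
          (Finset.disjoint_insert_left.2 ⟨hvB, hAB⟩) (by omega)
        omega

lemma disjoint_thickening {m r s : ℕ}
    (hG : ∀ U : Finset V, U.card ≤ m → (insideEdges G U).card ≤ U.card)
    {A B : Finset V} (hAB : Disjoint A B)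
    (hA : A.card ≤ (insideEdges G A).card) (hB : B.card ≤ (insideEdges G B).card)
    (h : A.card + B.card + (r + s) ≤ m + 1) :
    Disjoint (thickening G A r) (thickening G B s) := by
  rw [Finset.disjoint_left]
  intro x hx hx'
  obtain ⟨a, ha, w, hw⟩ := exists_walk_of_mem_thickening hx
  obtain ⟨b, hb, w', hw'⟩ := exists_walk_of_mem_thickening hx'
  have := lt_card_add_card_add_length hG (w.append w'.reverse) ha hb hAB hA hB
  rw [SimpleGraph.Walk.length_append, SimpleGraph.Walk.length_reverse] at this
  omega

/-- The vertex set of a cycle, which spans at least as many edges as it has vertices. -/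
lemma SimpleGraph.Walk.IsCycle.exists_finset_support {v : V} {p : G.Walk v v} (hp : p.IsCycle) :
    ∃ C : Finset V, (∀ x, x ∈ C ↔ x ∈ p.support) ∧ C.card = p.length ∧
      C.card ≤ (insideEdges G C).card := by
  have hcard : p.support.toFinset.card = p.length := by
    have h : p.support.toFinset = p.support.tail.toFinset := by
      conv_lhs => rw [← p.cons_tail_support]
      rw [List.toFinset_cons, Finset.insert_eq_self, List.mem_toFinset]
      exact SimpleGraph.Walk.end_mem_tail_support hp.not_nil
    rw [h, List.toFinset_card_of_nodup hp.support_nodup, List.length_tail,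
      SimpleGraph.Walk.length_support, Nat.add_sub_cancel]
  refine ⟨p.support.toFinset, fun x => List.mem_toFinset, hcard, ?_⟩
  rw [hcard, ← p.length_edges, ← List.toFinset_card_of_nodup hp.isCircuit.isTrail.edges_nodup]
  refine Finset.card_le_card fun e he => ?_
  rw [List.mem_toFinset] at he
  refine mem_insideEdges.2 ⟨p.edges_subset_edgeSet he, fun u hu => ?_⟩
  exact List.mem_toFinset.2 (p.mem_support_of_mem_edges he hu)

end Counting

/-- Let `d ≥ 3` and let `c > 0` be sufficiently small. Let `G` be a
`d`-regular graph on `n` vertices such that every set `U` with `|U| ≤ 3/(4c)` satisfies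
`e_G(U) ≤ (1+c)|U|`, and such that any two distinct cycles of `G` of length at most `1/(4c)`
are at distance at least `1/(4c)` from each other. Then the number of cycles of length at
most `1/(4c)` in `G` (counted as subgraphs, i.e. by their edge sets) is at most
`n/(d-1)^{1/(8c)}`. -/
theorem statement_7 (d : ℕ) (hd : 3 ≤ d) :
    ∃ c₀ > (0 : ℝ), ∀ c : ℝ, 0 < c → c ≤ c₀ →
    ∀ (n : ℕ) (G : SimpleGraph (Fin n)), isRegular G d →
    (∀ U : Set (Fin n), (U.ncard : ℝ) ≤ 3 / (4 * c) →
      (edgesWithin G U : ℝ) ≤ (1 + c) * U.ncard) →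
    (∀ (u v : Fin n) (c₁ : G.Walk u u) (c₂ : G.Walk v v),
      c₁.IsCycle → c₂.IsCycle →
      (c₁.length : ℝ) ≤ 1 / (4 * c) → (c₂.length : ℝ) ≤ 1 / (4 * c) →
      ({e | e ∈ c₁.edges} : Set (Sym2 (Fin n))) ≠ {e | e ∈ c₂.edges} →
      ∀ x ∈ c₁.support, ∀ y ∈ c₂.support, ∀ w : G.Walk x y,
        1 / (4 * c) ≤ (w.length : ℝ)) →
    (({E : Set (Sym2 (Fin n)) | ∃ (v : Fin n) (cc : G.Walk v v),
        cc.IsCycle ∧ (cc.length : ℝ) ≤ 1 / (4 * c) ∧ E = {e | e ∈ cc.edges}}).ncard : ℝ)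
      ≤ n / ((d : ℝ) - 1) ^ (1 / (8 * c)) := by
  have hd' : (3 : ℝ) ≤ d := by exact_mod_cast hd
  refine ⟨1 / (4 * d), by positivity, fun c hc hcd n G hreg hsparse hfar => ?_⟩
  set L : ℝ := 1 / (4 * c) with hL
  have hLpos : 0 < L := by positivity
  have hcL : c * L = 1 / 4 := by rw [hL]; field_simp
  have hLd : (d : ℝ) ≤ L := by
    rw [le_div_iff₀ (by positivity)] at hcd ⊢
    linarith
  have hL3 : 3 / (4 * c) = 3 * L := by rw [hL]; ring
  have hL2 : 1 / (8 * c) = L / 2 := by rw [hL]; field_simp; norm_num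
  rw [hL2]
  have hG : ∀ U : Finset (Fin n), U.card ≤ ⌊3 * L⌋₊ → (insideEdges G U).card ≤ U.card := by
    intro U hU
    have hU' : (U.card : ℝ) ≤ 3 * L := (Nat.le_floor_iff (by positivity)).1 hU
    have h := hsparse U (by rwa [hL3, Set.ncard_coe_finset])
    rw [edgesWithin_coe, Set.ncard_coe_finset] at h
    have : ((insideEdges G U).card : ℝ) < (U.card + 1 : ℕ) := by
      push_cast
      nlinarith [mul_le_mul_of_nonneg_left hU' hc.le]
    exact Nat.lt_succ_iff.1 (by exact_mod_cast this)
  set M : ℕ := ⌊(3 * L + 1) / 2⌋₊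
  have hM₁ : (M : ℝ) ≤ (3 * L + 1) / 2 := Nat.floor_le (by positivity)
  have hM₂ : (3 * L + 1) / 2 < M + 1 := Nat.lt_floor_add_one _
  have hMm : 2 * M ≤ ⌊3 * L⌋₊ + 1 := by
    have : ((2 * M - 1 : ℕ) : ℝ) ≤ 3 * L := by
      rcases Nat.eq_zero_or_pos M with h | h
      · simp [h, hLpos.le]
      · rw [Nat.cast_sub (by omega)]; push_cast; linarith
    have := Nat.le_floor this
    omega
  set S : Set (Set (Sym2 (Fin n))) := {E | ∃ (v : Fin n) (cc : G.Walk v v),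
    cc.IsCycle ∧ (cc.length : ℝ) ≤ L ∧ E = {e | e ∈ cc.edges}}
  have hcore : ∀ E ∈ S, ∃ C : Finset (Fin n), 3 ≤ C.card ∧ (C.card : ℝ) ≤ L ∧
      C.card ≤ (insideEdges G C).card ∧ ∃ (v : Fin n) (cc : G.Walk v v), cc.IsCycle ∧
        (cc.length : ℝ) ≤ L ∧ E = {e | e ∈ cc.edges} ∧ ∀ x, x ∈ C ↔ x ∈ cc.support := by
    rintro E ⟨v, cc, hcc, hlen, hE⟩
    obtain ⟨C, hsupp, hcard, hle⟩ := hcc.exists_finset_support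
    exact ⟨C, hcard ▸ hcc.three_le_length, hcard ▸ hlen, hle, v, cc, hcc, hlen, hE, hsupp⟩
  choose! C hC3 hCL hCe hCcyc using hcore
  let ball : Set (Sym2 (Fin n)) → Finset (Fin n) := fun E => thickening G (C E) (M - (C E).card)
  have hCM : ∀ E ∈ S, (C E).card ≤ M := by
    intro E hE
    have : ((C E).card : ℝ) < (M + 1 : ℕ) := by push_cast; linarith [hCL E hE]
    exact Nat.lt_succ_iff.1 (by exact_mod_cast this)
  have hdisj : ∀ E ∈ S, ∀ F ∈ S, E ≠ F → Disjoint (ball E) (ball F) := by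
    intro E hE F hF hne
    have h₁ := hCM E hE
    have h₂ := hCM F hF
    refine disjoint_thickening hG ?_ (hCe E hE) (hCe F hF) (by omega)
    obtain ⟨v, p, hp, hpL, hpE, hpC⟩ := hCcyc E hE
    obtain ⟨u, q, hq, hqL, hqF, hqC⟩ := hCcyc F hF
    rw [Finset.disjoint_left]
    intro x hx hx'
    rw [hpC] at hx
    rw [hqC] at hx'
    have := hfar v u p q hp hq hpL hqL (by rwa [← hpE, ← hqF]) x hx x hx' .nil
    simp only [SimpleGraph.Walk.length_nil, Nat.cast_zero] at this
    linarith
  have hball : ∀ E ∈ S, ((d : ℝ) - 1) ^ (L / 2) ≤ (ball E).card := by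
    intro E hE
    have h₁ := hCM E hE
    have h₃ := hC3 E hE
    have hgrow := card_mul_pow_le_card_thickening hreg hG (hCe E hE)
      (k := M - (C E).card) (by omega)
    have hgrow' : ((C E).card : ℝ) * ((d : ℝ) - 1) ^ (M - (C E).card) ≤ (ball E).card := by
      have h : (((C E).card * (d - 1) ^ (M - (C E).card) : ℕ) : ℝ) ≤ (ball E).card := by
        exact_mod_cast hgrow
      rwa [Nat.cast_mul, Nat.cast_pow, Nat.cast_sub (by omega), Nat.cast_one] at h
    refine le_trans ?_ hgrow'
    rw [← Real.rpow_natCast, Nat.cast_sub h₁]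
    have hCL' := hCL E hE
    have hC3' : (3 : ℝ) ≤ (C E).card := by exact_mod_cast h₃
    rcases le_total ((d : ℝ) - 1) (C E).card with h | h
    · calc ((d : ℝ) - 1) ^ (L / 2) ≤ ((d : ℝ) - 1) ^ (1 + ((M : ℝ) - (C E).card)) :=
            Real.rpow_le_rpow_of_exponent_le (by linarith) (by linarith)
        _ = ((d : ℝ) - 1) * ((d : ℝ) - 1) ^ ((M : ℝ) - (C E).card) := by
            rw [Real.rpow_add (by linarith), Real.rpow_one]
        _ ≤ _ := by exact mul_le_mul_of_nonneg_right h (Real.rpow_nonneg (by linarith) _)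
    · calc ((d : ℝ) - 1) ^ (L / 2) ≤ ((d : ℝ) - 1) ^ ((M : ℝ) - (C E).card) :=
            Real.rpow_le_rpow_of_exponent_le (by linarith) (by linarith)
        _ ≤ _ := le_mul_of_one_le_left (Real.rpow_nonneg (by linarith) _) (by linarith)
  have hpos : 0 < ((d : ℝ) - 1) ^ (L / 2) := Real.rpow_pos_of_pos (by linarith) _
  rw [le_div_iff₀ hpos, Set.ncard_eq_toFinset_card S (Set.toFinite S)]
  set T := (Set.toFinite S).toFinset
  have hT : ∀ E ∈ T, E ∈ S := fun E hE => (Set.toFinite S).mem_toFinset.1 hE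
  calc (T.card : ℝ) * ((d : ℝ) - 1) ^ (L / 2) = ∑ _E ∈ T, ((d : ℝ) - 1) ^ (L / 2) := by simp
    _ ≤ ∑ E ∈ T, ((ball E).card : ℝ) := Finset.sum_le_sum fun E hE => hball E (hT E hE)
    _ = ((T.biUnion ball).card : ℝ) := by
        rw [Finset.card_biUnion fun E hE F hF => hdisj E (hT E hE) F (hT F hF)]
        push_cast; rfl
    _ ≤ n := by exact_mod_cast (Finset.card_le_univ _).trans_eq (Fintype.card_fin n)
end

section
/- Let d ≥ 3 be an integer and let G be a d-regular graph on n vertices satisfying (P2) with a sufficiently small constant c > 0 (and with log^C n ≥ 3/(4c)). Then there is a set X ⊆ V(G) with |X| ≥ (1 - 1/(d-1)^{1/(16c)}) n such that for every v ∈ X, the ball B_G(v, 1/(16c)) contains no cycles, i.e., the subgraph of G induced on B_G(v, 1/(16c)) is a forest. -/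
open scoped Classical

open Finset in
/-- Inserting a new vertex `x` into `A` adds one edge for every neighbour of `x` in `A`. -/
theorem edgesWithin_insert {V : Type*} [Fintype V] (G : SimpleGraph V) {A : Finset V} {x : V}
    (hx : x ∉ A) :
    edgesWithin G (↑(insert x A) : Set V) = edgesWithin G (A : Set V) + #{a ∈ A | G.Adj x a} := by
  have hunion : {e ∈ G.edgeSet | ∀ v ∈ e, v ∈ (↑(insert x A) : Set V)} =
      {e ∈ G.edgeSet | ∀ v ∈ e, v ∈ (A : Set V)} ∪
        (fun a => s(x, a)) '' (↑({a ∈ A | G.Adj x a} : Finset V) : Set V) := by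
    ext e
    induction e using Sym2.ind with
    | _ a b =>
      simp only [Set.mem_ofPred_eq, SimpleGraph.mem_edgeSet, Sym2.mem_iff, forall_eq_or_imp,
        forall_eq, coe_insert, Set.mem_insert_iff, mem_coe, Set.mem_union, Set.mem_image,
        coe_filter, Sym2.eq_iff]
      constructor
      · rintro ⟨hab, rfl | ha, rfl | hb⟩
        · exact absurd hab (G.irrefl)
        · exact Or.inr ⟨b, ⟨hb, hab⟩, Or.inl ⟨rfl, rfl⟩⟩
        · exact Or.inr ⟨a, ⟨ha, hab.symm⟩, Or.inr ⟨rfl, rfl⟩⟩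
        · exact Or.inl ⟨hab, ha, hb⟩
      · rintro (⟨hab, ha, hb⟩ | ⟨c, ⟨hc, hxc⟩, ⟨rfl, rfl⟩ | ⟨rfl, rfl⟩⟩)
        · exact ⟨hab, Or.inr ha, Or.inr hb⟩
        · exact ⟨hxc, Or.inl rfl, Or.inr hc⟩
        · exact ⟨hxc.symm, Or.inr hc, Or.inl rfl⟩
  unfold edgesWithin
  rw [hunion, Set.ncard_union_eq _ (Set.toFinite _) (Set.toFinite _),
    Set.ncard_image_of_injective _ (fun a b h => Sym2.congr_right.1 h), Set.ncard_coe_finset]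
  rw [Set.disjoint_left]
  rintro _ ⟨_, h⟩ ⟨a, _, rfl⟩
  exact hx (h x (Sym2.mem_mk_left x a))

theorem edgesWithin_insert_of_adj {V : Type*} [Fintype V] (G : SimpleGraph V) {A : Finset V}
    {x a : V} (hx : x ∉ A) (ha : a ∈ A) (h : G.Adj x a) :
    edgesWithin G (A : Set V) + 1 ≤ edgesWithin G (↑(insert x A) : Set V) := by
  rw [edgesWithin_insert G hx]
  exact Nat.add_le_add_left (Finset.card_pos.2 ⟨a, by simp [ha, h]⟩) _

theorem edgesWithin_insert_of_two_adj {V : Type*} [Fintype V] (G : SimpleGraph V) {A : Finset V}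
    {x a b : V} (hx : x ∉ A) (ha : a ∈ A) (hxa : G.Adj x a) (hb : b ∈ A) (hxb : G.Adj x b)
    (hab : a ≠ b) :
    edgesWithin G (A : Set V) + 2 ≤ edgesWithin G (↑(insert x A) : Set V) := by
  rw [edgesWithin_insert G hx]
  exact Nat.add_le_add_left
    (Finset.one_lt_card.2 ⟨a, by simp [ha, hxa], b, by simp [hb, hxb], hab⟩) _

theorem edgesWithin_insert_le {V : Type*} [Fintype V] (G : SimpleGraph V) {A : Finset V} {x : V}
    (hx : x ∉ A) (h : ∀ a ∈ A, ∀ b ∈ A, G.Adj x a → G.Adj x b → a = b) :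
    edgesWithin G (↑(insert x A) : Set V) ≤ edgesWithin G (A : Set V) + 1 := by
  rw [edgesWithin_insert G hx]
  refine Nat.add_le_add_left (Finset.card_le_one.2 fun a ha b hb => ?_) _
  simp only [Finset.mem_filter] at ha hb
  exact h a ha.1 b hb.1 ha.2 hb.2

theorem edgesWithin_union_of_adj {V : Type*} [Fintype V] (G : SimpleGraph V) {A B : Finset V}
    (hAB : Disjoint A B) {a b : V} (ha : a ∈ A) (hb : b ∈ B) (h : G.Adj a b) :
    edgesWithin G (A : Set V) + edgesWithin G (B : Set V) + 1 ≤
      edgesWithin G (↑(A ∪ B) : Set V) := by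
  have hdisj : Disjoint {e ∈ G.edgeSet | ∀ v ∈ e, v ∈ (A : Set V)}
      {e ∈ G.edgeSet | ∀ v ∈ e, v ∈ (B : Set V)} := by
    rw [Set.disjoint_left]
    rintro e ⟨_, h₁⟩ ⟨_, h₂⟩
    induction e using Sym2.ind with
    | _ x y =>
      exact Finset.disjoint_left.1 hAB (h₁ x (Sym2.mem_mk_left x y)) (h₂ x (Sym2.mem_mk_left x y))
  have hnot : s(a, b) ∉ {e ∈ G.edgeSet | ∀ v ∈ e, v ∈ (A : Set V)} ∪
      {e ∈ G.edgeSet | ∀ v ∈ e, v ∈ (B : Set V)} := by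
    rintro (⟨_, h'⟩ | ⟨_, h'⟩)
    · exact Finset.disjoint_left.1 hAB (h' b (Sym2.mem_mk_right a b)) hb
    · exact Finset.disjoint_left.1 hAB ha (h' a (Sym2.mem_mk_left a b))
  unfold edgesWithin
  rw [← Set.ncard_union_eq hdisj (Set.toFinite _) (Set.toFinite _),
    ← Set.ncard_insert_of_notMem hnot (Set.toFinite _)]
  refine Set.ncard_le_ncard ?_ (Set.toFinite _)
  rintro e (rfl | ⟨he, h'⟩ | ⟨he, h'⟩)
  · refine ⟨h, fun v hv => ?_⟩
    rcases Sym2.mem_iff.1 hv with rfl | rfl <;> simp [ha, hb]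
  · exact ⟨he, fun v hv => by have := h' v hv; simp_all⟩
  · exact ⟨he, fun v hv => by have := h' v hv; simp_all⟩

open Finset in
theorem sum_card_adj_eq_two_mul_edgesWithin {V : Type*} [Fintype V] (G : SimpleGraph V)
    (A : Finset V) :
    ∑ a ∈ A, #{b ∈ A | G.Adj a b} = 2 * edgesWithin G (A : Set V) := by
  induction A using Finset.induction_on with
  | empty =>
    have h : {e ∈ G.edgeSet | ∀ v ∈ e, v ∈ ((∅ : Finset V) : Set V)} = ∅ := by
      refine Set.eq_empty_of_forall_notMem fun e he => ?_
      simpa using he.2 _ e.out_fst_mem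
    rw [edgesWithin, h, Set.ncard_empty, sum_empty, mul_zero]
  | insert x A hx ih =>
    have hA : ∑ a ∈ A, #{b ∈ insert x A | G.Adj a b} =
        ∑ a ∈ A, #{b ∈ A | G.Adj a b} + #{a ∈ A | G.Adj x a} := by
      rw [card_filter, ← sum_add_distrib]
      refine sum_congr rfl fun a _ => ?_
      rw [filter_insert, G.adj_comm x a]
      split_ifs
      · rw [card_insert_of_notMem (by simp [hx])]
      · rfl
    rw [sum_insert hx, hA, ih, edgesWithin_insert G hx, filter_insert, if_neg G.irrefl]
    ring

open Finset in
/-- In a `d`-regular graph, every edge meeting `A` lies within any `B` containing `A` and its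
neighbours, which bounds the number of edges within `B` from below. -/
theorem mul_card_le_edgesWithin_add {V : Type*} [Fintype V] (G : SimpleGraph V) {d : ℕ}
    (hG : isRegular G d) {A B : Finset V} (hAB : A ⊆ B) (hN : ∀ a ∈ A, ∀ b, G.Adj a b → b ∈ B) :
    d * #A ≤ edgesWithin G (A : Set V) + edgesWithin G (B : Set V) := by
  have hdeg : ∀ a ∈ A, #{b ∈ B | G.Adj a b} = d := by
    intro a ha
    rw [← hG a, ← Set.ncard_coe_finset]
    congr 1
    ext b
    simpa using hN a ha b
  have hsplit : ∀ a, #{b ∈ B | G.Adj a b} = #{b ∈ B \ A | G.Adj a b} + #{b ∈ A | G.Adj a b} := by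
    intro a
    simp only [card_filter]
    exact (sum_sdiff hAB).symm
  have hA := sum_card_adj_eq_two_mul_edgesWithin G A
  have hB := sum_card_adj_eq_two_mul_edgesWithin G B
  have hswap : ∑ b ∈ B \ A, #{a ∈ A | G.Adj b a} = ∑ a ∈ A, #{b ∈ B \ A | G.Adj a b} := by
    simp only [card_filter]
    rw [sum_comm]
    simp only [G.adj_comm]
  have hsum : ∑ a ∈ A, #{b ∈ B | G.Adj a b} = d * #A := by
    rw [sum_congr rfl hdeg, sum_const, smul_eq_mul, mul_comm]
  have hout : ∑ b ∈ B \ A, #{a ∈ A | G.Adj b a} ≤ ∑ b ∈ B \ A, #{a ∈ B | G.Adj b a} :=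
    sum_le_sum fun b _ => card_le_card (filter_subset_filter _ hAB)
  have hdecomp : ∑ a ∈ A, #{b ∈ B | G.Adj a b} =
      ∑ a ∈ A, #{b ∈ B \ A | G.Adj a b} + ∑ a ∈ A, #{b ∈ A | G.Adj a b} := by
    rw [← sum_add_distrib]
    exact sum_congr rfl fun a _ => hsplit a
  have hsdiff := sum_sdiff (f := fun b => #{a ∈ B | G.Adj b a}) hAB
  omega

/-- The vertices joined to `S` by a walk of length at most `t`. -/
noncomputable def ballAround {V : Type*} [Fintype V] (G : SimpleGraph V) (S : Finset V) (t : ℕ) :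
    Finset V :=
  {x | ∃ a ∈ S, ∃ w : G.Walk a x, w.length ≤ t}

theorem mem_ballAround {V : Type*} [Fintype V] {G : SimpleGraph V} {S : Finset V} {t : ℕ} {x : V} :
    x ∈ ballAround G S t ↔ ∃ a ∈ S, ∃ w : G.Walk a x, w.length ≤ t := by
  simp [ballAround]

theorem ballAround_zero {V : Type*} [Fintype V] (G : SimpleGraph V) (S : Finset V) :
    ballAround G S 0 = S := by
  ext x
  rw [mem_ballAround]
  constructor
  · rintro ⟨a, ha, w, hw⟩
    rwa [← SimpleGraph.Walk.eq_of_length_eq_zero (Nat.le_zero.1 hw)]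
  · exact fun hx => ⟨x, hx, SimpleGraph.Walk.nil, le_rfl⟩

theorem ballAround_mono {V : Type*} [Fintype V] (G : SimpleGraph V) (S : Finset V) {s t : ℕ}
    (hst : s ≤ t) : ballAround G S s ⊆ ballAround G S t := by
  intro x
  simp only [mem_ballAround]
  rintro ⟨a, ha, w, hw⟩
  exact ⟨a, ha, w, hw.trans hst⟩

theorem subset_ballAround {V : Type*} [Fintype V] (G : SimpleGraph V) (S : Finset V) (t : ℕ) :
    S ⊆ ballAround G S t := by
  simpa only [ballAround_zero] using ballAround_mono G S t.zero_le

theorem mem_ballAround_succ {V : Type*} [Fintype V] {G : SimpleGraph V} {S : Finset V} {t : ℕ}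
    {x : V} :
    x ∈ ballAround G S (t + 1) ↔ x ∈ ballAround G S t ∨ ∃ a ∈ ballAround G S t, G.Adj x a := by
  constructor
  · intro hx
    obtain ⟨a, ha, w, hw⟩ := mem_ballAround.1 hx
    rcases hw.lt_or_eq with hlt | heq
    · exact Or.inl (mem_ballAround.2 ⟨a, ha, w, Nat.lt_succ_iff.1 hlt⟩)
    · have hnil : ¬ w.Nil := by
        rw [← SimpleGraph.Walk.length_eq_zero_iff]
        omega
      refine Or.inr ⟨w.penultimate, mem_ballAround.2 ⟨a, ha, w.dropLast, ?_⟩,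
        (w.adj_penultimate hnil).symm⟩
      have := w.length_dropLast_add_one hnil
      omega
  · rintro (hx | ⟨a, ha, hadj⟩)
    · exact ballAround_mono G S t.le_succ hx
    · obtain ⟨b, hb, w, hw⟩ := mem_ballAround.1 ha
      exact mem_ballAround.2 ⟨b, hb, w.concat hadj.symm, by simpa using hw⟩

open Finset in
/-- A set `W ⊇ S` can be enlarged by at most `t` vertices of the `t`-ball around `S` so as to
contain a given vertex of that ball, each new vertex bringing at least one new edge. -/
theorem exists_superset_mem_of_mem_ballAround {V : Type*} [Fintype V] (G : SimpleGraph V)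
    {S W : Finset V} (hSW : S ⊆ W) {t : ℕ} {a : V} (ha : a ∈ ballAround G S t) :
    ∃ U, W ⊆ U ∧ U ⊆ W ∪ ballAround G S t ∧ a ∈ U ∧ #U ≤ #W + t ∧
      edgesWithin G (W : Set V) + #U ≤ edgesWithin G (U : Set V) + #W := by
  induction t generalizing a with
  | zero =>
    rw [ballAround_zero] at ha
    exact ⟨W, Subset.rfl, subset_union_left, hSW ha, le_rfl, le_rfl⟩
  | succ t ih =>
    have hmono : W ∪ ballAround G S t ⊆ W ∪ ballAround G S (t + 1) :=
      union_subset_union_right (ballAround_mono G S t.le_succ)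
    rcases mem_ballAround_succ.1 ha with h | ⟨b, hb, hab⟩
    · obtain ⟨U, hWU, hU, haU, hcard, hedge⟩ := ih h
      exact ⟨U, hWU, hU.trans hmono, haU, by omega, hedge⟩
    · obtain ⟨U, hWU, hU, hbU, hcard, hedge⟩ := ih hb
      by_cases haU : a ∈ U
      · exact ⟨U, hWU, hU.trans hmono, haU, by omega, hedge⟩
      · refine ⟨insert a U, hWU.trans (subset_insert _ _),
          insert_subset (mem_union_right _ ha) (hU.trans hmono), mem_insert_self _ _, ?_, ?_⟩
        · rw [card_insert_of_notMem haU]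
          omega
        · have := edgesWithin_insert_of_adj G haU hbU hab
          rw [card_insert_of_notMem haU]
          omega

open Finset in
/-- Two disjoint sets joined by a short walk lie in a slightly larger set whose excess of edges
over vertices exceeds the sum of theirs. -/
theorem exists_superset_of_disjoint_of_walk {V : Type*} [Fintype V] (G : SimpleGraph V)
    {A B : Finset V} (hAB : Disjoint A B) {a b : V} (ha : a ∈ A) (hb : b ∈ B) (w : G.Walk a b) :
    ∃ U : Finset V, #U ≤ #A + #B + w.length ∧
      edgesWithin G (A : Set V) + edgesWithin G (B : Set V) + #U + 1 ≤
        edgesWithin G (U : Set V) + #A + #B := by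
  induction w generalizing A with
  | nil => exact absurd hb (disjoint_left.1 hAB ha)
  | @cons a x b hadj w ih =>
    rw [SimpleGraph.Walk.length_cons]
    by_cases hxB : x ∈ B
    · refine ⟨A ∪ B, ?_, ?_⟩ <;> rw [card_union_of_disjoint hAB]
      · omega
      · have := edgesWithin_union_of_adj G hAB ha hxB hadj
        omega
    · by_cases hxA : x ∈ A
      · obtain ⟨U, hU, hedge⟩ := ih hAB hxA hb
        exact ⟨U, by omega, hedge⟩
      · obtain ⟨U, hU, hedge⟩ :=
          ih (disjoint_insert_left.2 ⟨hxB, hAB⟩) (mem_insert_self x A) hb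
        have := edgesWithin_insert_of_adj G hxA ha hadj.symm
        rw [card_insert_of_notMem hxA] at hU hedge
        exact ⟨U, by omega, by omega⟩

open Finset in
/-- Unless the `t`-ball around `S` contains a small set with larger excess of edges over vertices
than `S`, it arises from `S` by successively adding vertices with at most one earlier neighbour. -/
theorem ballAround_induction {V : Type*} [Fintype V] (G : SimpleGraph V) {S : Finset V}
    {P : Finset V → Prop} (hS : P S)
    (hinsert : ∀ A x, P A → x ∉ A → (∀ a ∈ A, ∀ b ∈ A, G.Adj x a → G.Adj x b → a = b) →
      P (insert x A)) (t : ℕ)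
    (hU : ∀ U, S ⊆ U → U ⊆ ballAround G S t → #U ≤ #S + 2 * t + 1 →
      edgesWithin G (U : Set V) + #S ≤ edgesWithin G (S : Set V) + #U) :
    P (ballAround G S t) := by
  induction t with
  | zero => rwa [ballAround_zero]
  | succ t ih =>
    have hmono := ballAround_mono G S t.le_succ
    have hball : P (ballAround G S t) :=
      ih fun U h₁ h₂ h₃ => hU U h₁ (h₂.trans hmono) (by omega)
    suffices h : ∀ N ⊆ ballAround G S (t + 1), P (ballAround G S t ∪ N) by
      have := h _ Subset.rfl
      rwa [union_eq_right.2 hmono] at this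
    intro N
    induction N using Finset.induction_on with
    | empty => intro _; simpa using hball
    | insert x N hx ihN =>
      intro hN
      rw [insert_subset_iff] at hN
      have hPN := ihN hN.2
      rw [union_insert]
      set A := ballAround G S t ∪ N
      by_cases hxA : x ∈ A
      · rwa [insert_eq_of_mem hxA]
      have hAball : A ⊆ ballAround G S (t + 1) := union_subset hmono hN.2
      have hSA : S ⊆ A := (subset_ballAround G S t).trans subset_union_left
      have hconn : ∀ y ∈ A, ∀ W, S ⊆ W → W ⊆ A → ∃ U, W ⊆ U ∧ U ⊆ A ∧ y ∈ U ∧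
          #U ≤ #W + (t + 1) ∧
          edgesWithin G (W : Set V) + #U ≤ edgesWithin G (U : Set V) + #W := by
        intro y hy W hSW hWA
        rcases mem_ballAround_succ.1 (hAball hy) with h | ⟨b, hb, hyb⟩
        · obtain ⟨U, hWU, hU', hyU, hcard, hedge⟩ :=
            exists_superset_mem_of_mem_ballAround G hSW h
          exact ⟨U, hWU, hU'.trans (union_subset hWA subset_union_left), hyU, by omega, hedge⟩
        · obtain ⟨U, hWU, hU', hbU, hcard, hedge⟩ :=
            exists_superset_mem_of_mem_ballAround G hSW hb
          have hUA : U ⊆ A := hU'.trans (union_subset hWA subset_union_left)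
          by_cases hyU : y ∈ U
          · exact ⟨U, hWU, hUA, hyU, by omega, hedge⟩
          · have := edgesWithin_insert_of_adj G hyU hbU hyb
            refine ⟨insert y U, hWU.trans (subset_insert _ _), insert_subset hy hUA,
              mem_insert_self _ _, ?_, ?_⟩ <;> rw [card_insert_of_notMem hyU] <;> omega
      refine hinsert A x hPN hxA fun y hy z hz hxy hxz => ?_
      by_contra hyz
      obtain ⟨U₁, hSU₁, hU₁A, hyU₁, hcard₁, hedge₁⟩ := hconn y hy S Subset.rfl hSA
      obtain ⟨U₂, hU₁₂, hU₂A, hzU₂, hcard₂, hedge₂⟩ := hconn z hz U₁ hSU₁ hU₁A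
      have hxU : x ∉ U₂ := fun h => hxA (hU₂A h)
      have htwo := edgesWithin_insert_of_two_adj G hxU (hU₁₂ hyU₁) hxy hzU₂ hxz hyz
      have := hU (insert x U₂) ((hSU₁.trans hU₁₂).trans (subset_insert _ _))
        (insert_subset hN.1 (hU₂A.trans hAball))
        (by rw [card_insert_of_notMem hxU]; omega)
      rw [card_insert_of_notMem hxU] at this
      omega

theorem not_isCycle_of_support_subset_insert {V : Type*} (G : SimpleGraph V) {A : Finset V} {x : V}
    (hA : ∀ (u : V) (p : G.Walk u u), p.IsCycle → ¬ ∀ y ∈ p.support, y ∈ A)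
    (hx : ∀ a ∈ A, ∀ b ∈ A, G.Adj x a → G.Adj x b → a = b)
    (u : V) (p : G.Walk u u) (hp : p.IsCycle) : ¬ ∀ y ∈ p.support, y ∈ insert x A := by
  intro hsupp
  by_cases hxp : x ∈ p.support
  · have hq := hp.rotate hxp
    have hqsupp : ∀ y ∈ (p.rotate x hxp).support, y ∈ insert x A := fun y hy =>
      hsupp y ((p.mem_support_rotate_iff x hxp).1 hy)
    set q := p.rotate x hxp
    have hsnd := q.adj_snd hq.not_nil
    have hpen := (q.adj_penultimate hq.not_nil).symm
    have h₁ := Finset.mem_of_mem_insert_of_ne (hqsupp _ (q.getVert_mem_support 1)) hsnd.ne'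
    have h₂ := Finset.mem_of_mem_insert_of_ne (hqsupp _ (q.getVert_mem_support _)) hpen.ne'
    exact hq.snd_ne_penultimate (hx _ h₁ _ h₂ hsnd hpen)
  · exact hA u p hp fun y hy =>
      Finset.mem_of_mem_insert_of_ne (hsupp y hy) fun h => hxp (h ▸ hy)

open Finset in
/-- If the `r`-ball around `v` contains a cycle, it contains a small set around `v` with at least
as many edges as vertices. -/
theorem exists_card_le_edgesWithin_of_isCycle {V : Type*} [Fintype V] (G : SimpleGraph V) {v : V}
    {r : ℕ} {u : V} {p : G.Walk u u} (hp : p.IsCycle)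
    (hsupp : ∀ y ∈ p.support, y ∈ ballAround G {v} r) :
    ∃ S, v ∈ S ∧ S ⊆ ballAround G {v} r ∧ #S ≤ 2 * r + 2 ∧ #S ≤ edgesWithin G (S : Set V) := by
  by_contra! hcon
  refine ballAround_induction G (S := {v})
    (P := fun A => ∀ (u : V) (p : G.Walk u u), p.IsCycle → ¬ ∀ y ∈ p.support, y ∈ A)
    ?_ ?_ r ?_ u p hp hsupp
  · intro u p hp h
    have h₁ := mem_singleton.1 (h _ (p.getVert_mem_support 1))
    have h₂ := mem_singleton.1 (h _ p.start_mem_support)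
    exact (p.adj_snd hp.not_nil).ne (h₂.trans h₁.symm)
  · exact fun A x hA _ hx => not_isCycle_of_support_subset_insert G hA hx
  · intro U hvU hU hcard
    rw [card_singleton] at hcard ⊢
    have := hcon U (hvU (mem_singleton_self v)) hU (by omega)
    omega

open Finset in
theorem edgesWithin_ballAround_le {V : Type*} [Fintype V] (G : SimpleGraph V) {S : Finset V}
    {t K : ℕ} (hK : ∀ U : Finset V, #U ≤ K → edgesWithin G (U : Set V) ≤ #U)
    (hS : #S ≤ edgesWithin G (S : Set V)) (hcard : #S + 2 * t + 1 ≤ K) :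
    edgesWithin G (ballAround G S t : Set V) ≤ #(ballAround G S t) := by
  refine ballAround_induction G (S := S) (P := fun A => edgesWithin G (A : Set V) ≤ #A)
    (hK S (by omega)) ?_ t ?_
  · intro A x hA hx hnbr
    have := edgesWithin_insert_le G hx hnbr
    rw [card_insert_of_notMem hx]
    omega
  · intro U _ _ hU
    have := hK U (by omega)
    omega

open Finset in
/-- Balls around a set with at least as many edges as vertices grow by a factor `d - 1`. -/
theorem pow_mul_card_ballAround_le {V : Type*} [Fintype V] (G : SimpleGraph V) {d : ℕ}
    (hG : isRegular G (d + 1)) {S : Finset V} {K : ℕ}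
    (hK : ∀ U : Finset V, #U ≤ K → edgesWithin G (U : Set V) ≤ #U)
    (hS : #S ≤ edgesWithin G (S : Set V)) (t k : ℕ) (hcard : #S + 2 * (t + k) + 1 ≤ K) :
    d ^ k * #(ballAround G S t) ≤ #(ballAround G S (t + k)) := by
  induction k with
  | zero => simp
  | succ k ih =>
    have h₁ := ih (by omega)
    have h₂ := edgesWithin_ballAround_le G hK hS (t := t + k) (by omega)
    have h₃ := edgesWithin_ballAround_le G hK hS (t := t + k + 1) (by omega)
    have h₄ := mul_card_le_edgesWithin_add G hG (ballAround_mono G S (t + k).le_succ)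
      fun a ha b hab => mem_ballAround_succ.2 (Or.inr ⟨a, ha, hab.symm⟩)
    calc d ^ (k + 1) * #(ballAround G S t) = d * (d ^ k * #(ballAround G S t)) := by ring
      _ ≤ d * #(ballAround G S (t + k)) := Nat.mul_le_mul_left _ h₁
      _ ≤ #(ballAround G S (t + (k + 1))) := by
        rw [← add_assoc]
        rw [add_mul] at h₄
        simp only [Nat.succ_eq_add_one] at h₄
        omega

open Finset in
/-- In a locally sparse `(d + 1)`-regular graph, few vertices see a cycle within distance `r`. -/
theorem pow_mul_card_le_of_forall_isCycle {V : Type*} [Fintype V] (G : SimpleGraph V) {d r : ℕ}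
    (hG : isRegular G (d + 1))
    (hK : ∀ U : Finset V, #U ≤ 8 * r + 6 → edgesWithin G (U : Set V) ≤ #U)
    {B : Finset V}
    (hB : ∀ v ∈ B, ∃ (u : V) (p : G.Walk u u), p.IsCycle ∧
      ∀ y ∈ p.support, y ∈ ballAround G {v} r) :
    d ^ (r + 1) * #B ≤ Fintype.card V := by
  have hex : ∀ v, ∃ S : Finset V, v ∈ B → v ∈ S ∧ S ⊆ ballAround G {v} r ∧ #S ≤ 2 * r + 2 ∧
      #S ≤ edgesWithin G (S : Set V) := by
    intro v
    by_cases hv : v ∈ B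
    · obtain ⟨u, p, hp, hsupp⟩ := hB v hv
      obtain ⟨S, hS⟩ := exists_card_le_edgesWithin_of_isCycle G hp hsupp
      exact ⟨S, fun _ => hS⟩
    · exact ⟨∅, fun h => absurd h hv⟩
  choose S hS using hex
  let F : V → Finset V := fun v => ballAround G (S v) (2 * r + 1)
  obtain ⟨M, hM⟩ := Finset.exists_maximal
    (s := {M ∈ B.powerset | (↑(M : Finset V) : Set V).PairwiseDisjoint F})
    ⟨∅, by simp⟩
  have hMmem := hM.prop
  rw [mem_filter, mem_powerset] at hMmem
  obtain ⟨hMB, hMdisj⟩ := hMmem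
  have hmeet : ∀ u ∈ B, ∃ v ∈ M, ¬ Disjoint (S u) (S v) := by
    intro u hu
    obtain ⟨huS, -, hSu, heu⟩ := hS u hu
    by_cases huM : u ∈ M
    · exact ⟨u, huM, fun h => disjoint_left.1 h huS huS⟩
    obtain ⟨v, hvM, hFuv⟩ : ∃ v ∈ M, ¬ Disjoint (F u) (F v) := by
      by_contra! hcon
      refine huM (hM.le_of_ge (y := insert u M) ?_ (subset_insert u M) (mem_insert_self u M))
      rw [mem_filter, mem_powerset, coe_insert]
      exact ⟨insert_subset hu hMB, hMdisj.insert fun v hv _ => hcon v hv⟩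
    refine ⟨v, hvM, fun hdisj => ?_⟩
    obtain ⟨-, -, hSv, hev⟩ := hS v (hMB hvM)
    obtain ⟨z, hzu, hzv⟩ := not_disjoint_iff.1 hFuv
    obtain ⟨a, ha, w₁, hw₁⟩ := mem_ballAround.1 hzu
    obtain ⟨b, hb, w₂, hw₂⟩ := mem_ballAround.1 hzv
    obtain ⟨U, hU, hedge⟩ :=
      exists_superset_of_disjoint_of_walk G hdisj ha hb (w₁.append w₂.reverse)
    rw [SimpleGraph.Walk.length_append, SimpleGraph.Walk.length_reverse] at hU
    have := hK U (by omega)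
    omega
  have hcover : B ⊆ M.biUnion fun v => ballAround G (S v) r := by
    intro u hu
    obtain ⟨v, hvM, huv⟩ := hmeet u hu
    obtain ⟨z, hzu, hzv⟩ := not_disjoint_iff.1 huv
    obtain ⟨a, ha, w, hw⟩ := mem_ballAround.1 ((hS u hu).2.1 hzu)
    rw [mem_singleton] at ha
    subst ha
    exact mem_biUnion.2 ⟨v, hvM, mem_ballAround.2 ⟨z, hzv, w.reverse, by simpa using hw⟩⟩
  calc d ^ (r + 1) * #B
      ≤ d ^ (r + 1) * ∑ v ∈ M, #(ballAround G (S v) r) :=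
        Nat.mul_le_mul_left _ ((card_le_card hcover).trans card_biUnion_le)
    _ = ∑ v ∈ M, d ^ (r + 1) * #(ballAround G (S v) r) := mul_sum _ _ _
    _ ≤ ∑ v ∈ M, #(F v) := sum_le_sum fun v hv => by
        obtain ⟨-, -, hSv, hev⟩ := hS v (hMB hv)
        have := pow_mul_card_ballAround_le G hG hK hev r (r + 1) (by omega)
        rwa [show r + (r + 1) = 2 * r + 1 by ring] at this
    _ = #(M.biUnion F) := (card_biUnion hMdisj).symm
    _ ≤ Fintype.card V := card_le_univ _

/-- Let `d ≥ 3` and let `G` be a `d`-regular graph on `n` vertices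
satisfying (P2) with a sufficiently small constant `c > 0` (and with `log^C n ≥ 3/(4c)`).
Then there is a set `X` with `|X| ≥ (1 - 1/(d-1)^{1/(16c)}) n` such that for every `v ∈ X`
the ball `B_G(v, 1/(16c))` contains no cycles. -/
theorem statement_8 (d : ℕ) (hd : 3 ≤ d) :
    ∃ c₀ > (0 : ℝ), ∀ c : ℝ, 0 < c → c ≤ c₀ → ∀ C : ℝ,
    ∀ (n : ℕ) (G : SimpleGraph (Fin n)), isRegular G d →
    3 / (4 * c) ≤ Real.log n ^ C →
    (∀ U : Set (Fin n), (U.ncard : ℝ) ≤ Real.log n ^ C →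
      (edgesWithin G U : ℝ) ≤ (1 + c) * U.ncard) →
    ∃ X : Set (Fin n),
      (1 - 1 / ((d : ℝ) - 1) ^ (1 / (16 * c))) * n ≤ (X.ncard : ℝ) ∧
      ∀ v ∈ X, ∀ (x : Fin n) (cc : G.Walk x x), cc.IsCycle →
        ∃ y ∈ cc.support, ¬ ∃ w : G.Walk v y, (w.length : ℝ) ≤ 1 / (16 * c) := by
  refine ⟨1 / 32, by norm_num, ?_⟩
  intro c hc hc₀ C n G hG hlog hP2
  obtain ⟨D, rfl⟩ : ∃ D, d = D + 1 := ⟨d - 1, by omega⟩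
  set R : ℝ := 1 / (16 * c) with hR
  have hcR : c * R = 1 / 16 := by rw [hR]; field_simp
  have hR2 : 2 ≤ R := by rw [hR, le_div_iff₀ (by positivity)]; linarith
  have hlogR : 12 * R ≤ Real.log n ^ C := by
    refine le_of_eq_of_le ?_ hlog
    rw [hR]; field_simp; norm_num
  set r := ⌊R⌋₊
  have hrR : (r : ℝ) ≤ R := Nat.floor_le (by linarith)
  have hRr : R < (r + 1 : ℕ) := by exact_mod_cast Nat.lt_floor_add_one R
  have hK : ∀ U : Finset (Fin n), U.card ≤ 8 * r + 6 →
      edgesWithin G (U : Set (Fin n)) ≤ U.card := by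
    intro U hU
    have hU' : (U.card : ℝ) ≤ 8 * r + 6 := by exact_mod_cast hU
    have hU12 : (U.card : ℝ) ≤ 12 * R := by linarith
    have h := hP2 U (by rw [Set.ncard_coe_finset]; linarith)
    rw [Set.ncard_coe_finset] at h
    have hlt : (edgesWithin G (U : Set (Fin n)) : ℝ) < (U.card + 1 : ℕ) := by
      push_cast
      nlinarith [mul_le_mul_of_nonneg_left hU12 hc.le]
    exact Nat.lt_succ_iff.1 (by exact_mod_cast hlt)
  let B : Finset (Fin n) := {v | ∃ (u : Fin n) (p : G.Walk u u), p.IsCycle ∧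
    ∀ y ∈ p.support, y ∈ ballAround G {v} r}
  have hB := pow_mul_card_le_of_forall_isCycle G hG hK (B := B) (by simp [B])
  rw [Fintype.card_fin] at hB
  refine ⟨(↑Bᶜ : Set (Fin n)), ?_, ?_⟩
  · have hD : (2 : ℝ) ≤ D := by exact_mod_cast (by omega : 2 ≤ D)
    have hpos : 0 < (D : ℝ) ^ R := Real.rpow_pos_of_pos (by linarith) R
    have hpow : (D : ℝ) ^ R ≤ (D : ℝ) ^ (r + 1) := by
      rw [← Real.rpow_natCast]
      exact Real.rpow_le_rpow_of_exponent_le (by linarith) hRr.le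
    have hBR : (D : ℝ) ^ (r + 1) * B.card ≤ n := by exact_mod_cast hB
    have hcard : ((Bᶜ.card : ℕ) : ℝ) = n - B.card := by
      have h := Finset.card_compl_add_card B
      rw [Fintype.card_fin] at h
      rw [eq_sub_iff_add_eq]
      exact_mod_cast h
    have hle : (B.card : ℝ) ≤ 1 / (D : ℝ) ^ R * n := by
      rw [one_div, inv_mul_eq_div, le_div_iff₀ hpos, mul_comm]
      exact (mul_le_mul_of_nonneg_right hpow (Nat.cast_nonneg _)).trans hBR
    rw [Set.ncard_coe_finset, hcard]
    push_cast
    rw [add_sub_cancel_right, sub_mul, one_mul]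
    linarith
  · intro v hv x p hp
    by_contra! hcon
    rw [Finset.mem_coe, Finset.mem_compl] at hv
    refine hv (Finset.mem_filter.2 ⟨Finset.mem_univ v, x, p, hp, fun y hy => ?_⟩)
    obtain ⟨w, hw⟩ := hcon y hy
    exact mem_ballAround.2 ⟨v, Finset.mem_singleton_self v, w, Nat.le_floor hw⟩
end

section
/- Fix an integer d ≥ 3 and constants 1 < λ < d-1, and set p = λ/(d-1). There exists a constant c_0 = c_0(λ) > 0 such that for every 0 < c ≤ c_0 and every C > 1 the following holds for every n: if G is a d-regular graph on n vertices satisfying (P2), then for every vertex v ∈ V(G) and every integer k with 1/(16c) ≤ k ≤ log^C n, the probability that the connected component of v in G_p has exactly k vertices is at most exp(-(λ-1)² k/(4λ)). -/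
open scoped Classical

/-- The total Bernoulli weight of the subsets of `E₁ ∪ E₂` in an event that only depends on the
trace on `E₁` is the total weight of that event on `E₁`. -/
lemma sum_bernoulli_union {α : Type*} [DecidableEq α] {E₁ E₂ : Finset α} (hdisj : Disjoint E₁ E₂) (p : ℝ)
    (Q : Finset α → Prop) (hQ : ∀ A ⊆ E₁, ∀ B ⊆ E₂, (Q (A ∪ B) ↔ Q A)) :
    (∑ S ∈ (E₁ ∪ E₂).powerset with Q S,
        p ^ S.card * (1 - p) ^ ((E₁ ∪ E₂).card - S.card))
      = ∑ A ∈ E₁.powerset with Q A, p ^ A.card * (1 - p) ^ (E₁.card - A.card) := by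
  have hinner : ∀ A ∈ E₁.powerset.filter Q,
      p ^ A.card * (1 - p) ^ (E₁.card - A.card)
        = ∑ B ∈ E₂.powerset, (p ^ A.card * (1 - p) ^ (E₁.card - A.card)) *
            (p ^ B.card * (1 - p) ^ (E₂.card - B.card)) := by
    intro A _
    rw [← Finset.mul_sum, Finset.sum_pow_mul_eq_add_pow]
    simp
  rw [Finset.sum_congr rfl hinner, ← Finset.sum_product']
  symm
  refine Finset.sum_bij' (fun x _ => x.1 ∪ x.2) (fun S _ => (S ∩ E₁, S ∩ E₂)) ?_ ?_ ?_ ?_ ?_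
  · rintro ⟨A, B⟩ h
    simp only [Finset.mem_product, Finset.mem_filter, Finset.mem_powerset] at h ⊢
    exact ⟨Finset.union_subset_union h.1.1 h.2, (hQ A h.1.1 B h.2).2 h.1.2⟩
  · intro S h
    simp only [Finset.mem_product, Finset.mem_filter, Finset.mem_powerset] at h ⊢
    refine ⟨⟨Finset.inter_subset_right, ?_⟩, Finset.inter_subset_right⟩
    refine (hQ _ Finset.inter_subset_right _ (Finset.inter_subset_right (s₁ := S))).1 ?_
    rw [← Finset.inter_union_distrib_left, Finset.inter_eq_left.2 h.1]
    exact h.2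
  · rintro ⟨A, B⟩ h
    simp only [Finset.mem_product, Finset.mem_filter, Finset.mem_powerset] at h
    have h₁ : B ∩ E₁ = ∅ :=
      Finset.disjoint_iff_inter_eq_empty.1 (hdisj.mono_right h.2).symm
    have h₂ : A ∩ E₂ = ∅ :=
      Finset.disjoint_iff_inter_eq_empty.1 (hdisj.mono_left h.1.1)
    simp [Finset.union_inter_distrib_right, h₁, h₂, Finset.inter_eq_left.2 h.1.1,
      Finset.inter_eq_left.2 h.2]
  · intro S h
    simp only [Finset.mem_filter, Finset.mem_powerset] at h
    simp only
    rw [← Finset.inter_union_distrib_left, Finset.inter_eq_left.2 h.1]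
  · rintro ⟨A, B⟩ h
    simp only [Finset.mem_product, Finset.mem_filter, Finset.mem_powerset] at h
    have hA := Finset.card_le_card h.1.1
    have hB := Finset.card_le_card h.2
    simp only
    rw [Finset.card_union_of_disjoint hdisj,
      Finset.card_union_of_disjoint (Finset.disjoint_of_subset_left h.1.1
        (Finset.disjoint_of_subset_right h.2 hdisj)),
      show E₁.card + E₂.card - (A.card + B.card)
        = (E₁.card - A.card) + (E₂.card - B.card) by omega, pow_add, pow_add]
    ring

/-- Change of measure between two Bernoulli weights, for `a` successes among `m + b` trials, where
`a ≤ m`. -/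
lemma bernoulli_change_of_measure {p q : ℝ} (hq : 0 < q) (hqp : q ≤ p) (hp : p ≤ 1) (hq1 : q < 1)
    {a m b : ℕ} (ham : a ≤ m) :
    p ^ a * (1 - p) ^ (m + b - a)
      ≤ (p / q) ^ m * ((1 - p) / (1 - q)) ^ b * (q ^ a * (1 - q) ^ (m + b - a)) := by
  have h1q : 0 < 1 - q := by linarith
  have hr0 : 0 ≤ (1 - p) / (1 - q) := div_nonneg (by linarith) h1q.le
  have hr1 : (1 - p) / (1 - q) ≤ 1 := (div_le_one h1q).2 (by linarith)
  have hs1 : 1 ≤ p / q := (one_le_div hq).2 hqp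
  have e₁ : p ^ a = (p / q) ^ a * q ^ a := by rw [← mul_pow, div_mul_cancel₀ _ hq.ne']
  have e₂ : (1 - p) ^ (m + b - a) = ((1 - p) / (1 - q)) ^ (m + b - a) * (1 - q) ^ (m + b - a) := by
    rw [← mul_pow, div_mul_cancel₀ _ h1q.ne']
  rw [e₁, e₂, mul_mul_mul_comm]
  have i₁ : (p / q) ^ a ≤ (p / q) ^ m := pow_le_pow_right₀ hs1 ham
  have i₂ : ((1 - p) / (1 - q)) ^ (m + b - a) ≤ ((1 - p) / (1 - q)) ^ b :=
    pow_le_pow_of_le_one hr0 hr1 (by omega)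
  gcongr

section Graph

variable {V : Type*} [Fintype V]

/-- The edges of `G` with both endpoints in `U`. -/
noncomputable def innerEdges (G : SimpleGraph V) (U : Finset V) : Finset (Sym2 V) :=
  {e ∈ G.edgeFinset | ∀ v ∈ e, v ∈ U}

/-- The edges of `G` with at least one endpoint in `U`. -/
noncomputable def touchingEdges (G : SimpleGraph V) (U : Finset V) : Finset (Sym2 V) :=
  {e ∈ G.edgeFinset | ∃ v ∈ e, v ∈ U}

/-- The vertex set of the component of `v` in the graph with edge set `S`. -/
noncomputable def cluster (v : V) (S : Finset (Sym2 V)) : Finset V :=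
  {u | (SimpleGraph.fromEdgeSet (S : Set (Sym2 V))).Reachable v u}

lemma mem_cluster {v u : V} {S : Finset (Sym2 V)} :
    u ∈ cluster v S ↔ (SimpleGraph.fromEdgeSet (S : Set (Sym2 V))).Reachable v u := by
  simp [cluster]

lemma cluster_mono (v : V) {S T : Finset (Sym2 V)} (h : S ⊆ T) : cluster v S ⊆ cluster v T := by
  intro u hu
  rw [mem_cluster] at hu ⊢
  exact hu.mono (SimpleGraph.fromEdgeSet_mono (by exact_mod_cast h))

lemma mem_cluster_of_edge {v x y : V} {S : Finset (Sym2 V)} (hx : x ∈ cluster v S)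
    (h : s(x, y) ∈ S) : y ∈ cluster v S := by
  rw [mem_cluster] at hx ⊢
  rcases eq_or_ne x y with rfl | hne
  · exact hx
  · exact hx.trans (SimpleGraph.Adj.reachable (by simp [h, hne]))

lemma compCard_eq_card_cluster (v : V) (S : Finset (Sym2 V)) :
    compCard (SimpleGraph.fromEdgeSet (S : Set (Sym2 V))) v = (cluster v S).card := by
  rw [compCard, ← Set.ncard_coe_finset]
  congr 1
  ext u
  simp [mem_cluster]

lemma edgesWithin_eq_card_innerEdges (G : SimpleGraph V) (U : Finset V) :
    edgesWithin G (U : Set V) = (innerEdges G U).card := by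
  rw [edgesWithin, ← Set.ncard_coe_finset]
  congr 1
  ext e
  simp [innerEdges]

/-- Adding edges that avoid a set containing the cluster does not change the cluster. -/
lemma cluster_union_eq {v : V} {A B : Finset (Sym2 V)} {U : Finset V} (hA : cluster v A ⊆ U)
    (hB : ∀ e ∈ B, ∀ x ∈ e, x ∉ U) : cluster v (A ∪ B) = cluster v A := by
  refine (Finset.Subset.antisymm ?_ (cluster_mono v Finset.subset_union_left))
  intro u hu
  rw [mem_cluster, SimpleGraph.reachable_iff_reflTransGen] at hu
  induction hu with
  | refl => rw [mem_cluster]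
  | @tail x y _ hxy ih =>
    have hmem : s(x, y) ∈ A ∪ B := by
      have := (SimpleGraph.fromEdgeSet_adj _).1 hxy
      exact_mod_cast this.1
    rcases Finset.mem_union.1 hmem with h | h
    · exact mem_cluster_of_edge ih h
    · exact absurd (hA ih) (hB _ h x (Sym2.mem_mk_left x y))

/-- In a `d`-regular graph, the degree sum over `U` counts inner edges twice and the other touching
edges once. -/
lemma regular_mul_card_le {G : SimpleGraph V} {d : ℕ} (hG : isRegular G d) (U : Finset V) :
    d * U.card ≤ (innerEdges G U).card + (touchingEdges G U).card := by
  have hdeg : ∀ u ∈ U, d = ∑ e ∈ G.edgeFinset, if u ∈ e then 1 else 0 := by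
    intro u _
    rw [← Finset.card_filter, ← G.incidenceFinset_eq_filter, G.card_incidenceFinset_eq_degree,
      ← hG u, Set.ncard_eq_toFinset_card', SimpleGraph.degree, SimpleGraph.neighborFinset]
  calc d * U.card = ∑ u ∈ U, d := by simp [mul_comm]
    _ = ∑ u ∈ U, ∑ e ∈ G.edgeFinset, (if u ∈ e then 1 else 0) := Finset.sum_congr rfl hdeg
    _ = ∑ e ∈ G.edgeFinset, ∑ u ∈ U, (if u ∈ e then 1 else 0) := Finset.sum_comm
    _ ≤ ∑ e ∈ G.edgeFinset, ((if ∀ v ∈ e, v ∈ U then 1 else 0)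
          + (if ∃ v ∈ e, v ∈ U then 1 else 0)) := by
        refine Finset.sum_le_sum fun e _ => ?_
        induction e with
        | _ x y =>
          rw [← Finset.card_filter]
          have hsub : (U.filter fun u => u ∈ s(x, y)) = ({x, y} : Finset V) ∩ U := by
            ext u
            simp [and_comm]
          rw [hsub]
          have h2 : (({x, y} : Finset V) ∩ U).card ≤ 2 :=
            (Finset.card_le_card Finset.inter_subset_left).trans Finset.card_le_two
          by_cases hx : x ∈ U <;> by_cases hy : y ∈ U <;>
            simp [hx, hy, Finset.insert_inter_of_mem, Finset.insert_inter_of_notMem] at h2 ⊢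
          exact h2
    _ = _ := by
        rw [Finset.sum_add_distrib, ← Finset.card_filter, ← Finset.card_filter]
        rfl

lemma cluster_event_local (G : SimpleGraph V) (v : V) (U : Finset V) :
    ∀ A ⊆ touchingEdges G U, ∀ B ⊆ G.edgeFinset \ touchingEdges G U,
      (cluster v (A ∪ B) = U ↔ cluster v A = U) := by
  intro A _ B hB
  have hB' : ∀ e ∈ B, ∀ x ∈ e, x ∉ U := by
    intro e he x hx hxU
    have := Finset.mem_sdiff.1 (hB he)
    exact this.2 (by simpa [touchingEdges] using ⟨by simpa using this.1, x, hx, hxU⟩)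
  constructor
  · intro h
    rw [← h]
    exact (cluster_union_eq ((cluster_mono v Finset.subset_union_left).trans h.subset) hB').symm
  · intro h
    rw [cluster_union_eq h.subset hB', h]

lemma subset_innerEdges_of_cluster_eq {G : SimpleGraph V} {v : V} {U : Finset V}
    {A : Finset (Sym2 V)} (hA : A ⊆ touchingEdges G U) (h : cluster v A = U) :
    A ⊆ innerEdges G U := by
  intro e he
  obtain ⟨heG, x, hx, hxU⟩ := Finset.mem_filter.1 (hA he)
  refine Finset.mem_filter.2 ⟨heG, ?_⟩
  obtain ⟨y, rfl⟩ := Sym2.mem_iff_exists.1 hx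
  intro z hz
  rcases Sym2.mem_iff.1 hz with rfl | rfl
  · exact hxU
  · rw [← h] at hxU ⊢
    exact mem_cluster_of_edge hxU he

lemma innerEdges_subset_touchingEdges (G : SimpleGraph V) (U : Finset V) :
    innerEdges G U ⊆ touchingEdges G U := by
  intro e he
  obtain ⟨heG, h⟩ := Finset.mem_filter.1 he
  refine Finset.mem_filter.2 ⟨heG, ?_⟩
  induction e with
  | _ x y => exact ⟨x, Sym2.mem_mk_left x y, h x (Sym2.mem_mk_left x y)⟩

/-- Comparison of the probabilities of a given cluster under two percolation parameters. -/
lemma sum_percWeight_cluster_le (G : SimpleGraph V) (v : V) (U : Finset V) {p q : ℝ}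
    (hq : 0 < q) (hqp : q ≤ p) (hp : p ≤ 1) (hq1 : q < 1) :
    ∑ S ∈ G.edgeFinset.powerset with cluster v S = U, percWeight G p S
      ≤ (p / q) ^ (innerEdges G U).card *
          ((1 - p) / (1 - q)) ^ ((touchingEdges G U).card - (innerEdges G U).card) *
        ∑ S ∈ G.edgeFinset.powerset with cluster v S = U, percWeight G q S := by
  have hun : touchingEdges G U ∪ (G.edgeFinset \ touchingEdges G U) = G.edgeFinset :=
    Finset.union_sdiff_of_subset (Finset.filter_subset _ _)
  have hsum : ∀ r : ℝ, (∑ S ∈ G.edgeFinset.powerset with cluster v S = U, percWeight G r S)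
      = ∑ A ∈ (touchingEdges G U).powerset with cluster v A = U,
          r ^ A.card * (1 - r) ^ ((touchingEdges G U).card - A.card) := by
    intro r
    have := sum_bernoulli_union (E₁ := touchingEdges G U)
      (E₂ := G.edgeFinset \ touchingEdges G U) Finset.disjoint_sdiff r
      (fun S => cluster v S = U) (cluster_event_local G v U)
    rw [hun] at this
    unfold percWeight
    convert this
  rw [hsum, hsum, Finset.mul_sum]
  refine Finset.sum_le_sum fun A hA => ?_
  obtain ⟨hA, hAU⟩ := Finset.mem_filter.1 hA
  have hle := Finset.card_le_card
    (subset_innerEdges_of_cluster_eq (Finset.mem_powerset.1 hA) hAU)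
  have hle' := Finset.card_le_card (innerEdges_subset_touchingEdges G U)
  have := bernoulli_change_of_measure hq hqp hp hq1 hle
    (b := (touchingEdges G U).card - (innerEdges G U).card)
  rwa [Nat.add_sub_cancel' hle'] at this

/-- A uniform bound on the likelihood ratios of all possible clusters of size `k` bounds the
probability that the cluster of `v` has size `k`. -/
lemma percProb_compCard_le (G : SimpleGraph V) (v : V) (k : ℕ) {p q K : ℝ}
    (hq : 0 < q) (hqp : q ≤ p) (hp : p ≤ 1) (hq1 : q < 1) (hK0 : 0 ≤ K)
    (hK : ∀ U : Finset V, U.card = k →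
      (p / q) ^ (innerEdges G U).card *
        ((1 - p) / (1 - q)) ^ ((touchingEdges G U).card - (innerEdges G U).card) ≤ K) :
    percProb G p (fun S => compCard (SimpleGraph.fromEdgeSet (S : Set (Sym2 V))) v = k) ≤ K := by
  have hw : ∀ S, 0 ≤ percWeight G q S := fun S =>
    mul_nonneg (pow_nonneg hq.le _) (pow_nonneg (by linarith) _)
  have htot : ∑ S ∈ G.edgeFinset.powerset, percWeight G q S = 1 := by
    unfold percWeight
    rw [Finset.sum_pow_mul_eq_add_pow]
    simp
  have hle : ∀ U : Finset V, U.card = k →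
      ∑ S ∈ G.edgeFinset.powerset with cluster v S = U, percWeight G p S
        ≤ K * ∑ S ∈ G.edgeFinset.powerset with cluster v S = U, percWeight G q S :=
    fun U hU => (sum_percWeight_cluster_le G v U hq hqp hp hq1).trans
      (mul_le_mul_of_nonneg_right (hK U hU) (Finset.sum_nonneg fun S _ => hw S))
  calc percProb G p (fun S => compCard (SimpleGraph.fromEdgeSet (S : Set (Sym2 V))) v = k)
      = ∑ S ∈ G.edgeFinset.powerset with (cluster v S).card = k, percWeight G p S := by
        simp only [percProb, compCard_eq_card_cluster, Finset.sum_filter]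
    _ = ∑ U : Finset V with U.card = k,
          ∑ S ∈ G.edgeFinset.powerset with cluster v S = U, percWeight G p S := by
        rw [← Finset.sum_fiberwise_of_maps_to (t := Finset.univ.filter fun U : Finset V => U.card = k)
          (g := cluster v) (by intro S hS; simpa using (Finset.mem_filter.1 hS).2)]
        refine Finset.sum_congr rfl fun U hU => Finset.sum_congr ?_ fun _ _ => rfl
        have hU := (Finset.mem_filter.1 hU).2
        ext S
        simp only [Finset.mem_filter]
        constructor
        · rintro ⟨⟨h, _⟩, h'⟩
          exact ⟨h, h'⟩
        · rintro ⟨h, h'⟩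
          exact ⟨⟨h, h' ▸ hU⟩, h'⟩
    _ ≤ ∑ U : Finset V with U.card = k,
          K * ∑ S ∈ G.edgeFinset.powerset with cluster v S = U, percWeight G q S :=
        Finset.sum_le_sum fun U hU => hle U (Finset.mem_filter.1 hU).2
    _ ≤ ∑ U : Finset V,
          K * ∑ S ∈ G.edgeFinset.powerset with cluster v S = U, percWeight G q S :=
        Finset.sum_le_sum_of_subset_of_nonneg (Finset.filter_subset _ _) fun U _ _ =>
          mul_nonneg hK0 (Finset.sum_nonneg fun S _ => hw S)
    _ = K := by
        rw [← Finset.mul_sum, Finset.sum_fiberwise, htot, mul_one]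

end Graph

lemma log_le_sub_inv_half {x : ℝ} (hx : 1 ≤ x) : Real.log x ≤ (x - x⁻¹) / 2 := by
  rw [← Real.sinh_log (by linarith)]
  exact Real.self_le_sinh_iff.2 (Real.log_nonneg hx)

/-- The exponent estimate for the likelihood ratio of a cluster with `k` vertices and `e` inner
edges. -/
lemma likelihood_ratio_le {lam D c k e b : ℝ} (hlam : 1 < lam) (hD : 1 ≤ D) (hk : 0 ≤ k)
    (hc0 : 0 < c) (hc : c ≤ (lam - 1) / (12 * lam)) (he : e ≤ (1 + c) * k)
    (hb : (D + 2) * k ≤ 2 * e + b) :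
    e * Real.log lam - b * ((lam - 1) / D) ≤ -(lam - 1) ^ 2 * k / (4 * lam) := by
  have hl0 : 0 < Real.log lam := Real.log_pos hlam
  have hlog := log_le_sub_inv_half hlam.le
  have hlog' : Real.log lam ≤ lam - 1 := Real.log_le_sub_one_of_pos (by linarith)
  have h₁ : e * Real.log lam ≤ (1 + c) * k * Real.log lam :=
    mul_le_mul_of_nonneg_right he hl0.le
  have h₂ : (D - 2 * c) * k ≤ b := by linarith
  have hy : 0 ≤ (lam - 1) / D := div_nonneg (by linarith) (by linarith)
  have hy' : (lam - 1) / D ≤ lam - 1 := div_le_self (by linarith) hD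
  have hDy : D * ((lam - 1) / D) = lam - 1 := mul_div_cancel₀ _ (by linarith)
  have h₃ := mul_le_mul_of_nonneg_right h₂ hy
  have h₄ : (D - 2 * c) * k * ((lam - 1) / D) = k * (lam - 1) - 2 * c * k * ((lam - 1) / D) := by
    linear_combination k * hDy
  have hck : 0 ≤ c * k := by positivity
  have h₅ := mul_le_mul_of_nonneg_left hy' hck
  have h₆ := mul_le_mul_of_nonneg_left hlog' hck
  have h₇ := mul_le_mul_of_nonneg_left hlog hk
  have h₈ := mul_le_mul_of_nonneg_right hc (mul_nonneg hk (sub_nonneg.2 hlam.le))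
  have hE : k * ((lam - lam⁻¹) / 2) - k * (lam - 1)
      + 3 * ((lam - 1) / (12 * lam) * (k * (lam - 1))) = -(lam - 1) ^ 2 * k / (4 * lam) := by
    field_simp
    ring
  linarith

/-- Fix `d ≥ 3`, `1 < λ < d-1`, and `p = λ/(d-1)`. There is a constant
`c₀ = c₀(λ) > 0` such that for every `0 < c ≤ c₀` and every `C > 1`, for every `n`: if `G` is
a `d`-regular graph on `n` vertices satisfying (P2), then for every vertex `v` and every
integer `k` with `1/(16c) ≤ k ≤ log^C n`, the probability that the component of `v` in `G_p`
has exactly `k` vertices is at most `exp(-(λ-1)² k/(4λ))`. -/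
theorem statement_9 (d : ℕ) (hd : 3 ≤ d) (lam : ℝ) (hlam₁ : 1 < lam)
    (hlam₂ : lam < (d : ℝ) - 1) (p : ℝ) (hp : p = lam / ((d : ℝ) - 1)) :
    ∃ c₀ > (0 : ℝ), ∀ c : ℝ, 0 < c → c ≤ c₀ → ∀ C : ℝ, 1 < C →
    ∀ (n : ℕ) (G : SimpleGraph (Fin n)), isRegular G d →
    (∀ U : Set (Fin n), (U.ncard : ℝ) ≤ Real.log n ^ C →
      (edgesWithin G U : ℝ) ≤ (1 + c) * U.ncard) →
    ∀ (v : Fin n) (k : ℕ), 1 / (16 * c) ≤ (k : ℝ) → (k : ℝ) ≤ Real.log n ^ C →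
    percProb G p
        (fun S => compCard (SimpleGraph.fromEdgeSet (↑S : Set (Sym2 (Fin n)))) v = k)
      ≤ Real.exp (-(lam - 1) ^ 2 * k / (4 * lam)) := by
  have hlam0 : 0 < lam := by linarith
  refine ⟨(lam - 1) / (12 * lam), div_pos (by linarith) (by linarith), ?_⟩
  intro c hc0 hc C _ n G hG hP v k _ hk
  have hd3 : (3 : ℝ) ≤ d := by exact_mod_cast hd
  have hd1 : (0 : ℝ) < d - 1 := by linarith
  have hp1 : p ≤ 1 := by
    rw [hp, div_le_one hd1]
    exact hlam₂.le
  refine percProb_compCard_le (q := 1 / ((d : ℝ) - 1)) G v k (by positivity)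
    (by rw [hp]; gcongr) hp1 (by rw [div_lt_one hd1]; linarith) (Real.exp_pos _).le ?_
  intro U hU
  have hin : ((innerEdges G U).card : ℝ) ≤ (1 + c) * k := by
    have := hP U (by rwa [Set.ncard_coe_finset, hU])
    rwa [Set.ncard_coe_finset, hU, edgesWithin_eq_card_innerEdges] at this
  have hle := Finset.card_le_card (innerEdges_subset_touchingEdges G U)
  have hreg := regular_mul_card_le hG U
  rw [hU] at hreg
  set e := (innerEdges G U).card
  set b := (touchingEdges G U).card - e with hbdef
  have hreg' : ((d : ℝ) - 2 + 2) * k ≤ 2 * e + b := by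
    have : d * k ≤ 2 * e + b := by omega
    rw [sub_add_cancel]
    exact_mod_cast this
  have hratio : p / (1 / ((d : ℝ) - 1)) = lam := by
    rw [hp]
    field_simp
  have hratio' : (1 - p) / (1 - 1 / ((d : ℝ) - 1)) = 1 - (lam - 1) / ((d : ℝ) - 2) := by
    have h2 : (d : ℝ) - 2 ≠ 0 := by linarith
    have h2' : (d : ℝ) - 1 - 1 ≠ 0 := by intro h; apply h2; linarith
    rw [hp]
    field_simp
    ring
  have hnonneg : 0 ≤ 1 - (lam - 1) / ((d : ℝ) - 2) := by
    rw [sub_nonneg, div_le_one (by linarith)]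
    linarith
  rw [hratio, hratio']
  calc lam ^ e * (1 - (lam - 1) / ((d : ℝ) - 2)) ^ b
      ≤ Real.exp (Real.log lam) ^ e * Real.exp (-((lam - 1) / ((d : ℝ) - 2))) ^ b := by
        rw [Real.exp_log hlam0]
        gcongr
        exact Real.one_sub_le_exp_neg _
    _ = Real.exp (e * Real.log lam - b * ((lam - 1) / ((d : ℝ) - 2))) := by
        rw [← Real.exp_nat_mul, ← Real.exp_nat_mul, ← Real.exp_add]
        congr 1
        ring
    _ ≤ _ := Real.exp_le_exp.2
        (likelihood_ratio_le hlam₁ (by linarith) (Nat.cast_nonneg k) hc0 hc hin hreg')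
end
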